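/- Let 0 < ε < 1 and C > 0 be constants. There exist constants r₀ and c (depending only on C and ε) such that the following holds for all sufficiently large n. Let A = (a_{ij}) be an n×n symmetric real matrix with ρ_q(A) ≥ n^{−C}. Then there exist disjoint index sets I₀, I ⊆ {1,…,n} with |I₀| ≤ r₀ and |I| ≥ n − c·n^ε, a nonzero integer k with |k| ≤ n^c, integers k_{i i₀} (i ∈ I, i₀ ∈ I₀) of absolute value at most n^c, and real numbers a'_{ij} (i, j ∈ I), such that for every i ∈ I: (i) a_{ij} = a'_{ij}/k² − Σ_{i₀∈I₀} k_{i i₀} a_{i₀ j}/k − Σ_{i₀∈I₀} k_{j i₀} a_{i₀ i}/k for all j ∈ I; and (ii) all but at most c·n^ε of the numbers a'_{ij}, j ∈ I, belong to a proper symmetric GAP Q_i (which may depend on i) of rank at most r₀ and size at most n^c. -/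

import Mathlib

open scoped Classical BigOperators

noncomputable section

/-- `Q` is a proper symmetric generalized arithmetic progression (GAP) of rank at most `r`
and size at most `s`. -/
def IsProperSymGAPSet (Q : Set ℝ) (r : ℕ) (s : ℝ) : Prop :=
  ∃ (r' : ℕ) (g : Fin r' → ℝ) (N : Fin r' → ℕ),
    r' ≤ r ∧
    Q = {x : ℝ | ∃ m : Fin r' → ℤ, (∀ i, |m i| ≤ (N i : ℤ)) ∧ x = ∑ i, (m i : ℝ) * g i} ∧
    (∀ m m' : Fin r' → ℤ, (∀ i, |m i| ≤ (N i : ℤ)) → (∀ i, |m' i| ≤ (N i : ℤ)) →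
      (∑ i, (m i : ℝ) * g i) = (∑ i, (m' i : ℝ) * g i) → m = m') ∧
    (∏ i, (2 * (N i : ℝ) + 1)) ≤ s

/-- The real number (±1) corresponding to a Boolean sign bit. -/
def signv (b : Bool) : ℝ := if b then 1 else -1

/-- The quadratic concentration probability `ρ_q(A) = sup_a P(Σ a_{ij} x_i x_j = a)`, where
`x` is a vector of iid Rademacher random variables. -/
def rhoQ (n : ℕ) (A : Matrix (Fin n) (Fin n) ℝ) : ℝ :=
  ⨆ a : ℝ, ((Finset.univ.filter fun x : Fin n → Bool =>
      ∑ i, ∑ j, A i j * signv (x i) * signv (x j) = a).card : ℝ) / 2 ^ n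

namespace QuadLO

section

/-- An element of the group algebra all of whose coefficients are nonnegative, sum to `1`, and
are invariant under negation: a finitely supported symmetric probability distribution. -/
structure IsSymmDist {G : Type*} [AddCommGroup G] (f : AddMonoidAlgebra ℝ G) : Prop where
  nonneg : ∀ x, 0 ≤ f.coeff x
  mass : AddMonoidAlgebra.lift ℝ ℝ G 1 f = 1
  symm : AddMonoidAlgebra.mapDomain (-(AddMonoidHom.id G)) f = f

variable {G H : Type*} [AddCommGroup G] [AddCommGroup H]

theorem coeff_mul_eq_sum (f g : AddMonoidAlgebra ℝ G) (x : G) :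
    (f * g).coeff x = ∑ a ∈ f.coeff.support, f.coeff a * g.coeff (x - a) := by
  rw [AddMonoidAlgebra.coeff_mul_apply_left, Finsupp.sum]
  refine Finset.sum_congr rfl fun a _ => ?_
  rw [neg_add_eq_sub]

namespace IsSymmDist

variable {f g : AddMonoidAlgebra ℝ G}

protected theorem one : IsSymmDist (1 : AddMonoidAlgebra ℝ G) where
  nonneg x := by
    rw [AddMonoidAlgebra.one_def, AddMonoidAlgebra.coeff_single, Finsupp.single_apply]
    split_ifs <;> norm_num
  mass := map_one _
  symm := AddMonoidAlgebra.mapDomain_one (-(AddMonoidHom.id G))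

protected theorem mul (hf : IsSymmDist f) (hg : IsSymmDist g) : IsSymmDist (f * g) where
  nonneg x := by
    rw [coeff_mul_eq_sum]
    exact Finset.sum_nonneg fun a _ => mul_nonneg (hf.nonneg a) (hg.nonneg _)
  mass := by rw [map_mul, hf.mass, hg.mass, one_mul]
  symm := by rw [AddMonoidAlgebra.mapDomain_mul, hf.symm, hg.symm]

protected theorem pow (hf : IsSymmDist f) : ∀ k : ℕ, IsSymmDist (f ^ k)
  | 0 => by simpa using IsSymmDist.one
  | k + 1 => by rw [pow_succ]; exact (hf.pow k).mul hf

protected theorem prod {ι : Type*} (s : Finset ι) {F : ι → AddMonoidAlgebra ℝ G}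
    (h : ∀ i, IsSymmDist (F i)) : IsSymmDist (∏ i ∈ s, F i) := by
  induction s using Finset.induction_on with
  | empty => simpa using IsSymmDist.one
  | insert a s ha ih => rw [Finset.prod_insert ha]; exact (h a).mul ih

theorem sum_support (hf : IsSymmDist f) : ∑ a ∈ f.coeff.support, f.coeff a = 1 := by
  rw [← hf.mass, AddMonoidAlgebra.lift_apply]
  simp [Finsupp.sum]

theorem sum_univ [Fintype G] (hf : IsSymmDist f) : ∑ a, f.coeff a = 1 := by
  rw [← hf.sum_support]
  refine (Finset.sum_subset (Finset.subset_univ _) fun x _ hx => ?_).symm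
  simpa using hx

theorem coeff_neg (hf : IsSymmDist f) (x : G) : f.coeff (-x) = f.coeff x := by
  conv_lhs => rw [← hf.symm]
  have := Finsupp.mapDomain_apply (f := (-(AddMonoidHom.id G) : G →+ G))
    (fun a b h => by simpa using h) f.coeff x
  simpa using this

theorem coeff_mul_le (hg : IsSymmDist g) {B : ℝ}
    (hB : ∀ x, f.coeff x ≤ B) (x : G) : (f * g).coeff x ≤ B := by
  rw [mul_comm, coeff_mul_eq_sum]
  calc _ ≤ ∑ a ∈ g.coeff.support, g.coeff a * B :=
        Finset.sum_le_sum fun a _ => mul_le_mul_of_nonneg_left (hB _) (hg.nonneg a)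
    _ = B := by rw [← Finset.sum_mul, hg.sum_support, one_mul]

theorem coeff_le_one (hf : IsSymmDist f) (x : G) : f.coeff x ≤ 1 := by
  rw [← one_mul f]
  refine hf.coeff_mul_le (fun y => ?_) x
  rw [AddMonoidAlgebra.one_def, AddMonoidAlgebra.coeff_single, Finsupp.single_apply]
  split_ifs <;> norm_num

theorem mul_self_coeff_zero (hf : IsSymmDist f) {s : Finset G} (hs : f.coeff.support ⊆ s) :
    (f * f).coeff 0 = ∑ a ∈ s, f.coeff a ^ 2 := by
  rw [coeff_mul_eq_sum]
  refine (Finset.sum_congr rfl fun a _ => ?_).trans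
    (Finset.sum_subset hs fun x _ hx => ?_)
  · rw [zero_sub, hf.coeff_neg, sq]
  · simp [Finsupp.notMem_support_iff.1 hx]

theorem coeff_mul_sq_le (hf : IsSymmDist f) (hg : IsSymmDist g) (x : G) :
    (f * g).coeff x ^ 2 ≤ (f * f).coeff 0 * (g * g).coeff 0 := by
  set s := f.coeff.support ∪ g.coeff.support.image (fun a => x - a)
  have h1 : (f * g).coeff x = ∑ a ∈ s, f.coeff a * g.coeff (x - a) := by
    rw [coeff_mul_eq_sum]
    exact Finset.sum_subset Finset.subset_union_left fun y _ hy => by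
      simp [Finsupp.notMem_support_iff.1 hy]
  have h2 : (g * g).coeff 0 = ∑ a ∈ s, g.coeff (x - a) ^ 2 := by
    rw [hg.mul_self_coeff_zero (s := s.image fun a => x - a)]
    · rw [Finset.sum_image fun a _ b _ h => by simpa using h]
    · intro a ha
      exact Finset.mem_image.2 ⟨x - a, Finset.mem_union_right _ (Finset.mem_image_of_mem _ ha),
        by abel⟩
  rw [h1, h2, hf.mul_self_coeff_zero (Finset.subset_union_left (s₂ := _))]
  exact Finset.sum_mul_sq_le_sq_mul_sq _ _ _

theorem coeff_mul_self_le (hf : IsSymmDist f) (x : G) : (f * f).coeff x ≤ (f * f).coeff 0 := by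
  have h0 := (hf.mul hf).nonneg 0
  refine (sq_le_sq₀ ((hf.mul hf).nonneg x) h0).1 ?_
  rw [sq ((f * f).coeff 0)]
  exact hf.coeff_mul_sq_le hf x

theorem coeff_zero_prod_le {ι : Type*} {X : ℝ} (hX : 0 ≤ X) :
    ∀ (a : ℕ) (s : Finset ι) (F : ι → AddMonoidAlgebra ℝ G), s.card = 2 ^ a →
      (∀ i, IsSymmDist (F i)) → (∀ i ∈ s, (F i ^ 2 ^ a).coeff 0 ≤ X) →
      (∏ i ∈ s, F i).coeff 0 ≤ X := by
  intro a
  induction a with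
  | zero =>
    intro s F hs _ hX'
    obtain ⟨i, rfl⟩ := Finset.card_eq_one.1 (by simpa using hs)
    simpa using hX'
  | succ a ih =>
    intro s F hs hF hX'
    obtain ⟨t, hts, htc⟩ := Finset.exists_subset_card_eq (s := s) (n := 2 ^ a)
      (by rw [hs, pow_succ]; omega)
    have key : ∀ u ⊆ s, u.card = 2 ^ a →
        ((∏ i ∈ u, F i) * ∏ i ∈ u, F i).coeff 0 ≤ X := by
      intro u hu huc
      rw [← Finset.prod_mul_distrib]
      refine ih u _ huc (fun i => (hF i).mul (hF i)) fun i hi => ?_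
      rw [← sq, ← pow_mul, ← pow_succ']
      exact hX' i (hu hi)
    have h1 := key t hts htc
    have h2 := key (s \ t) Finset.sdiff_subset
      (by rw [Finset.card_sdiff_of_subset hts, hs, htc, pow_succ]; omega)
    rw [← Finset.prod_sdiff hts]
    have h3 := (IsSymmDist.prod (s \ t) hF).coeff_mul_sq_le (IsSymmDist.prod t hF) 0
    have h4 := ((IsSymmDist.prod (s \ t) hF).mul (IsSymmDist.prod t hF)).nonneg 0
    have h5 := ((IsSymmDist.prod t hF).mul (IsSymmDist.prod t hF)).nonneg 0
    have h6 := ((IsSymmDist.prod (s \ t) hF).mul (IsSymmDist.prod (s \ t) hF)).nonneg 0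
    nlinarith [mul_le_mul h2 h1 h5 hX]

end IsSymmDist

/-- The distribution of `ξ • v`, where `ξ` is `±1` with probability `β` each and `0` otherwise. -/
def lazyStep (β : ℝ) (v : G) : AddMonoidAlgebra ℝ G :=
  AddMonoidAlgebra.single 0 (1 - 2 * β) + AddMonoidAlgebra.single v β +
    AddMonoidAlgebra.single (-v) β

theorem mapDomain_lazyStep (β : ℝ) (φ : G →+ H) (v : G) :
    AddMonoidAlgebra.mapDomainRingHom ℝ φ (lazyStep β v) = lazyStep β (φ v) := by
  simp [lazyStep, AddMonoidAlgebra.mapDomain_add, -AddMonoidAlgebra.single_sub]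

theorem isSymmDist_lazyStep {β : ℝ} (h0 : 0 ≤ β) (h1 : β ≤ 1 / 2) (v : G) :
    IsSymmDist (lazyStep β v) where
  nonneg x := by
    simp only [lazyStep, AddMonoidAlgebra.coeff_add, AddMonoidAlgebra.coeff_single,
      Finsupp.add_apply, Finsupp.single_apply]
    have : (0 : ℝ) ≤ 1 - 2 * β := by linarith
    split_ifs <;> positivity
  mass := by
    simp [lazyStep]
    ring
  symm := by
    simp only [lazyStep, AddMonoidAlgebra.mapDomain_add, AddMonoidAlgebra.mapDomain_single]
    simp only [AddMonoidHom.neg_apply, AddMonoidHom.id_apply, neg_neg, neg_zero]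
    abel

theorem coeff_mul_lazyStep (β : ℝ) (v : G) (f : AddMonoidAlgebra ℝ G) (x : G) :
    (f * lazyStep β v).coeff x =
      (1 - 2 * β) * f.coeff x + β * f.coeff (x - v) + β * f.coeff (x + v) := by
  simp only [lazyStep, mul_add, AddMonoidAlgebra.coeff_add, Finsupp.add_apply,
    AddMonoidAlgebra.coeff_mul_single_apply]
  simp only [neg_zero, add_zero, neg_neg, ← sub_eq_add_neg]
  ring

end

theorem nash_zmod {q : ℕ} [NeZero q] (f : ZMod q → ℝ) (hf : ∀ x, 0 ≤ f x) (hs : ∑ x, f x = 1)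
    (hN : 2 < (∑ x, f x ^ 2) * q) :
    (∑ x, f x ^ 2) ^ 3 ≤ 8 * ∑ x, (f x - f (x + 1)) ^ 2 := by
  set N := ∑ x, f x ^ 2 with hNdef
  set D := ∑ x, (f x - f (x + 1)) ^ 2 with hD
  have hq : (0 : ℝ) < q := by exact_mod_cast Nat.pos_of_ne_zero (NeZero.ne q)
  have hN0 : 0 < N := by
    by_contra h
    nlinarith
  obtain ⟨x₀, hx₀⟩ : ∃ x₀, N ≤ f x₀ := by
    by_contra! h
    have : N < N := by
      calc N = ∑ x, f x * f x := by simp [hNdef, sq]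
        _ < ∑ x, f x * N := by
          refine Finset.sum_lt_sum (fun x _ => mul_le_mul_of_nonneg_left (h x).le (hf x)) ?_
          obtain ⟨x, hx⟩ : ∃ x, 0 < f x := by
            by_contra! h'
            have : ∑ x, f x ≤ 0 := Finset.sum_nonpos fun x _ => h' x
            linarith
          exact ⟨x, Finset.mem_univ _, mul_lt_mul_of_pos_left (h x) hx⟩
        _ = N := by rw [← Finset.sum_mul, hs, one_mul]
    exact lt_irrefl _ this
  set L := ⌊2 / N⌋₊ with hL
  have hL1 : (L : ℝ) ≤ 2 / N := Nat.floor_le (by positivity)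
  have hL2 : 2 / N < L + 1 := Nat.lt_floor_add_one _
  have hLq : L < q := by
    have : (L : ℝ) < q := lt_of_le_of_lt hL1 ((div_lt_iff₀ hN0).2 (by linarith))
    exact_mod_cast this
  obtain ⟨i, hiL, hi⟩ : ∃ i ≤ L, f (x₀ + (i : ℕ)) ≤ N / 2 := by
    by_contra! h
    have h1 : ∑ i ∈ Finset.range (L + 1), f (x₀ + (i : ℕ)) ≤ 1 := by
      rw [← hs, ← Finset.sum_image (g := fun i : ℕ => x₀ + (i : ZMod q)) (f := f)]
      · exact Finset.sum_le_univ_sum_of_nonneg hf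
      · intro a ha b hb hab
        have hab' : (a : ZMod q) = b := by simpa using hab
        rw [Finset.mem_coe, Finset.mem_range] at ha hb
        rw [ZMod.natCast_eq_natCast_iff] at hab'
        exact Nat.ModEq.eq_of_lt_of_lt hab' (by omega) (by omega)
    have h2 : ∑ i ∈ Finset.range (L + 1), N / 2 ≤
        ∑ i ∈ Finset.range (L + 1), f (x₀ + (i : ℕ)) :=
      Finset.sum_le_sum fun i hi => (h i (by simpa [Nat.lt_succ_iff] using hi)).le
    rw [Finset.sum_const, Finset.card_range, nsmul_eq_mul] at h2
    rw [div_lt_iff₀ hN0] at hL2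
    push_cast at h2
    linarith
  have htel : f x₀ - f (x₀ + (i : ℕ)) =
      ∑ l ∈ Finset.range i, (f (x₀ + (l : ℕ)) - f (x₀ + (l : ℕ) + 1)) := by
    have := Finset.sum_range_sub' (fun l : ℕ => f (x₀ + (l : ZMod q))) i
    rw [← show f (x₀ + ((0 : ℕ) : ZMod q)) = f x₀ by simp, ← this]
    simp [add_assoc]
  have hcs : (f x₀ - f (x₀ + (i : ℕ))) ^ 2 ≤ i * D := by
    rw [htel]
    refine sq_sum_le_card_mul_sum_sq.trans ?_
    rw [Finset.card_range]
    refine mul_le_mul_of_nonneg_left ?_ (Nat.cast_nonneg _)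
    rw [← Finset.sum_image (g := fun i : ℕ => x₀ + (i : ZMod q))
      (f := fun x => (f x - f (x + 1)) ^ 2)]
    · exact Finset.sum_le_univ_sum_of_nonneg fun x => sq_nonneg _
    · intro a ha b hb hab
      have hab' : (a : ZMod q) = b := by simpa using hab
      rw [Finset.mem_coe, Finset.mem_range] at ha hb
      rw [ZMod.natCast_eq_natCast_iff] at hab'
      exact Nat.ModEq.eq_of_lt_of_lt hab' (by omega) (by omega)
  have hD0 : 0 ≤ D := Finset.sum_nonneg fun x _ => sq_nonneg _
  have h3 : (N / 2) ^ 2 ≤ 2 / N * D := by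
    calc (N / 2) ^ 2 ≤ (f x₀ - f (x₀ + (i : ℕ))) ^ 2 := by
          apply pow_le_pow_left₀ (by positivity); linarith
      _ ≤ i * D := hcs
      _ ≤ 2 / N * D := by
          refine mul_le_mul_of_nonneg_right (le_trans ?_ hL1) hD0
          exact_mod_cast hiL
  have h4 : N * (N / 2) ^ 2 ≤ 2 * D := by
    calc N * (N / 2) ^ 2 ≤ N * (2 / N * D) := mul_le_mul_of_nonneg_left h3 hN0.le
      _ = 2 * D := by field_simp
  nlinarith

theorem sum_sq_mul_lazyStep {q : ℕ} [NeZero q] (β : ℝ) (f : AddMonoidAlgebra ℝ (ZMod q)) :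
    ∑ x, (f * lazyStep β 1).coeff x ^ 2 ≤
      ∑ x, f.coeff x ^ 2 - 2 * (β * (1 - 2 * β)) * ∑ x, (f.coeff x - f.coeff (x + 1)) ^ 2 := by
  have e1 : ∑ x : ZMod q, f.coeff (x - 1) ^ 2 = ∑ x, f.coeff x ^ 2 :=
    Fintype.sum_equiv (Equiv.subRight 1) _ _ fun x => rfl
  have e2 : ∑ x : ZMod q, f.coeff (x + 1) ^ 2 = ∑ x, f.coeff x ^ 2 :=
    Fintype.sum_equiv (Equiv.addRight 1) _ _ fun x => rfl
  have e3 : ∑ x : ZMod q, (f.coeff (x - 1) - f.coeff x) ^ 2 =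
      ∑ x, (f.coeff x - f.coeff (x + 1)) ^ 2 :=
    Fintype.sum_equiv (Equiv.subRight 1) _ _ fun x => by simp
  have : ∀ x : ZMod q, (f * lazyStep β 1).coeff x ^ 2 ≤
      (1 - 2 * β) * f.coeff x ^ 2 + β * f.coeff (x - 1) ^ 2 + β * f.coeff (x + 1) ^ 2
      - β * (1 - 2 * β) * (f.coeff (x - 1) - f.coeff x) ^ 2
      - β * (1 - 2 * β) * (f.coeff x - f.coeff (x + 1)) ^ 2 := by
    intro x
    rw [coeff_mul_lazyStep]
    nlinarith [sq_nonneg (β * (f.coeff (x - 1) - f.coeff (x + 1)))]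
  refine (Finset.sum_le_sum fun x _ => this x).trans (le_of_eq ?_)
  simp only [Finset.sum_sub_distrib, Finset.sum_add_distrib, ← Finset.mul_sum]
  rw [e1, e2, e3]
  ring

theorem sum_sq_lazyStep_pow_le {q : ℕ} [NeZero q] {β : ℝ} (hβ : 1 / 8 ≤ β) (hβ' : β ≤ 1 / 4)
    {δ : ℝ} (hδ : 0 < δ) (hδq : 2 ≤ δ * q) {J : ℕ} (hJ : 64 < J * δ ^ 3) :
    ∑ x, ((lazyStep β (1 : ZMod q)) ^ J).coeff x ^ 2 ≤ δ := by
  have hd : IsSymmDist (lazyStep β (1 : ZMod q)) :=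
    isSymmDist_lazyStep (by linarith) (by linarith) _
  have hq : (0 : ℝ) < q := by exact_mod_cast Nat.pos_of_ne_zero (NeZero.ne q)
  have hβ2 : 3 / 16 ≤ 2 * (β * (1 - 2 * β)) := by nlinarith
  have key : ∀ j : ℕ, ∑ x, ((lazyStep β (1 : ZMod q)) ^ j).coeff x ^ 2 ≤ δ ∨
      ∑ x, ((lazyStep β (1 : ZMod q)) ^ j).coeff x ^ 2 ≤ 1 - j * (δ ^ 3 / 64) := by
    intro j
    induction j with
    | zero =>
      right
      rw [← (hd.pow 0).mul_self_coeff_zero (Finset.subset_univ _)]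
      simp
    | succ j ih =>
      have h1 := sum_sq_mul_lazyStep β ((lazyStep β (1 : ZMod q)) ^ j)
      rw [← pow_succ] at h1
      have hD : 0 ≤ ∑ x, (((lazyStep β (1 : ZMod q)) ^ j).coeff x -
          ((lazyStep β (1 : ZMod q)) ^ j).coeff (x + 1)) ^ 2 :=
        Finset.sum_nonneg fun x _ => sq_nonneg _
      by_cases h : ∑ x, ((lazyStep β (1 : ZMod q)) ^ j).coeff x ^ 2 ≤ δ
      · left
        nlinarith
      · right
        have ih' := ih.resolve_left h
        push Not at h
        have h2 := nash_zmod _ (hd.pow j).nonneg (hd.pow j).sum_univ (by nlinarith)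
        have h3 : δ ^ 3 ≤ (∑ x, ((lazyStep β (1 : ZMod q)) ^ j).coeff x ^ 2) ^ 3 :=
          pow_le_pow_left₀ hδ.le h.le 3
        push_cast
        nlinarith
  rcases key J with h | h
  · exact h
  · have : ∑ x, ((lazyStep β (1 : ZMod q)) ^ J).coeff x ^ 2 ≥ 0 :=
      Finset.sum_nonneg fun x _ => sq_nonneg _
    linarith

theorem coeff_lazyStep_pow_le_three_quarters {q : ℕ} (hq : 2 ≤ q) {β : ℝ} (hβ : 1 / 8 ≤ β)
    (hβ' : β ≤ 1 / 4) (J : ℕ) (x : ZMod q) :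
    ((lazyStep β (1 : ZMod q)) ^ (J + 1)).coeff x ≤ 3 / 4 := by
  have hd : IsSymmDist (lazyStep β (1 : ZMod q)) :=
    isSymmDist_lazyStep (by linarith) (by linarith) _
  have : Fact (1 < q) := ⟨hq⟩
  rw [pow_succ']
  refine (hd.pow J).coeff_mul_le (fun y => ?_) x
  simp only [lazyStep, AddMonoidAlgebra.coeff_add, AddMonoidAlgebra.coeff_single,
    Finsupp.add_apply, Finsupp.single_apply]
  by_cases hy : y = 0
  · subst hy
    simp
    linarith
  · rw [if_neg (Ne.symm hy)]
    split_ifs <;> linarith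

theorem exists_coeff_lazyStep_pow_le : ∃ a₀ : ℕ, ∀ a ≥ a₀, ∀ β : ℝ, 1 / 8 ≤ β → β ≤ 1 / 4 →
    ∀ q : ℕ, 2 ≤ q → ∀ x : ZMod q,
      ((lazyStep β (1 : ZMod q)) ^ 2 ^ (a + 1)).coeff x ^ 16 * min (q : ℝ) (2 ^ (a + 1)) ≤ 1 := by
  refine ⟨100, fun a ha β hβ hβ' q hq x => ?_⟩
  have : NeZero q := ⟨by omega⟩
  have hd : IsSymmDist (lazyStep β (1 : ZMod q)) :=
    isSymmDist_lazyStep (by linarith) (by linarith) _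
  set t := ((lazyStep β (1 : ZMod q)) ^ 2 ^ (a + 1)).coeff x with ht
  have ht0 : 0 ≤ t := (hd.pow _).nonneg x
  have hq0 : (0 : ℝ) < q := by positivity
  have htJ : t ≤ ∑ y, ((lazyStep β (1 : ZMod q)) ^ 2 ^ a).coeff y ^ 2 := by
    rw [ht, pow_succ, mul_two, pow_add, ← (hd.pow _).mul_self_coeff_zero (Finset.subset_univ _)]
    exact (hd.pow _).coeff_mul_self_le x
  rcases Nat.eq_or_lt_of_le hq with rfl | hq3
  · have h1 : t ≤ 3 / 4 := by
      obtain ⟨J, hJ⟩ : ∃ J, 2 ^ (a + 1) = J + 1 :=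
        ⟨2 ^ (a + 1) - 1, by have := Nat.one_le_two_pow (n := a + 1); omega⟩
      rw [ht, hJ]
      exact coeff_lazyStep_pow_le_three_quarters le_rfl hβ hβ' J x
    calc t ^ 16 * min ((2 : ℕ) : ℝ) (2 ^ (a + 1)) ≤ (3 / 4) ^ 16 * 2 := by
          gcongr
          exact (min_le_left _ _).trans (by norm_num)
      _ ≤ 1 := by norm_num
  · set l := (a + 1) / 16 + 1 with hl
    have hl1 : a + 1 ≤ 16 * l := by omega
    have hl2 : 3 * l + 7 ≤ a := by omega
    have hMl : (2 : ℝ) ^ (a + 1) ≤ (2 ^ l) ^ 16 := by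
      rw [← pow_mul]
      exact pow_le_pow_right₀ (by norm_num) (by omega)
    have hJ : (64 : ℝ) < (2 ^ a : ℕ) * (1 / 2 ^ l) ^ 3 := by
      have h1 : (2 : ℝ) ^ (3 * l + 7) ≤ 2 ^ a := pow_le_pow_right₀ (by norm_num) hl2
      rw [pow_add, mul_comm 3 l, pow_mul] at h1
      push_cast
      rw [div_pow, one_pow, mul_one_div, lt_div_iff₀ (by positivity)]
      have : (0 : ℝ) < (2 ^ l) ^ 3 := by positivity
      linarith
    by_cases hc : (2 : ℝ) / q ≤ 1 / 2 ^ l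
    · have h2 : t ≤ 1 / 2 ^ l := htJ.trans (sum_sq_lazyStep_pow_le hβ hβ' (by positivity)
        ((div_le_iff₀ hq0).1 hc) hJ)
      calc t ^ 16 * min (q : ℝ) (2 ^ (a + 1)) ≤ (1 / 2 ^ l) ^ 16 * (2 ^ l) ^ 16 := by
            gcongr
            exact (min_le_right _ _).trans hMl
        _ = 1 := by rw [← mul_pow, one_div_mul_cancel (by positivity), one_pow]
    · push Not at hc
      have h2 : t ≤ 2 / q := htJ.trans (sum_sq_lazyStep_pow_le hβ hβ' (by positivity)
        (by rw [div_mul_cancel₀ _ hq0.ne']) (hJ.trans_le (by gcongr)))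
      have hq3' : (3 : ℝ) ≤ q := by exact_mod_cast hq3
      calc t ^ 16 * min (q : ℝ) (2 ^ (a + 1)) ≤ (2 / q) ^ 16 * q := by
            gcongr
            exact min_le_left _ _
        _ = 2 ^ 16 / (q : ℝ) ^ 15 := by field_simp
        _ ≤ 2 ^ 16 / 3 ^ 15 := by gcongr
        _ ≤ 1 := by norm_num

theorem exists_coeff_lazyStep_pow_mul_le : ∃ a₀ : ℕ, ∀ a ≥ a₀, ∀ β : ℝ, 1 / 8 ≤ β → β ≤ 1 / 4 →
    ∀ B : ℕ, 1 ≤ B → ∀ q : ℕ, 2 ≤ q → q ≤ (2 ^ (a + 1)) ^ B → ∀ x : ZMod q,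
      ((lazyStep β (1 : ZMod q)) ^ 2 ^ (a + 1)).coeff x ^ (16 * B) * q ≤ 1 := by
  obtain ⟨a₀, h⟩ := exists_coeff_lazyStep_pow_le
  refine ⟨a₀, fun a ha β hβ hβ' B hB q hq hqB x => ?_⟩
  have hd : IsSymmDist (lazyStep β (1 : ZMod q)) :=
    isSymmDist_lazyStep (by linarith) (by linarith) _
  have h1 := h a ha β hβ hβ' q hq x
  set t := ((lazyStep β (1 : ZMod q)) ^ 2 ^ (a + 1)).coeff x with ht
  have ht0 : 0 ≤ t := (hd.pow _).nonneg x
  have ht1 : t ≤ 1 := (hd.pow _).coeff_le_one x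
  rcases le_total (q : ℝ) (2 ^ (a + 1)) with hc | hc
  · rw [min_eq_left hc] at h1
    refine le_trans (mul_le_mul_of_nonneg_right ?_ (Nat.cast_nonneg _)) h1
    exact pow_le_pow_of_le_one ht0 ht1 (by omega)
  · rw [min_eq_right hc] at h1
    calc t ^ (16 * B) * q ≤ t ^ (16 * B) * (2 ^ (a + 1)) ^ B := by
          gcongr
          exact_mod_cast hqB
      _ = (t ^ 16 * 2 ^ (a + 1)) ^ B := by rw [pow_mul, mul_pow]
      _ ≤ 1 := pow_le_one₀ (by positivity) h1

section

variable {G H : Type*} [AddCommGroup G] [AddCommGroup H]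

theorem exists_zsmul_of_coeff_lazyStep_pow_ne_zero {β : ℝ} {v : G} :
    ∀ {J : ℕ} {x : G}, ((lazyStep β v) ^ J).coeff x ≠ 0 → ∃ y : ℤ, |y| ≤ J ∧ x = y • v := by
  intro J
  induction J with
  | zero =>
    intro x hx
    refine ⟨0, by simp, ?_⟩
    rw [pow_zero, AddMonoidAlgebra.one_def, AddMonoidAlgebra.coeff_single,
      Finsupp.single_apply] at hx
    have : (0 : G) = x := by by_contra h; exact hx (if_neg h)
    simp [this]
  | succ J ih =>
    intro x hx
    rw [pow_succ, coeff_mul_lazyStep] at hx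
    by_cases h1 : ((lazyStep β v) ^ J).coeff x ≠ 0
    · obtain ⟨y, hy, rfl⟩ := ih h1
      exact ⟨y, by push_cast; omega, rfl⟩
    by_cases h2 : ((lazyStep β v) ^ J).coeff (x - v) ≠ 0
    · obtain ⟨y, hy, h⟩ := ih h2
      refine ⟨y + 1, ?_, ?_⟩
      · rw [abs_le] at *; push_cast; omega
      · rw [add_zsmul, one_zsmul, ← h, sub_add_cancel]
    by_cases h3 : ((lazyStep β v) ^ J).coeff (x + v) ≠ 0
    · obtain ⟨y, hy, h⟩ := ih h3
      refine ⟨y - 1, ?_, ?_⟩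
      · rw [abs_le] at *; push_cast; omega
      · rw [sub_zsmul, one_zsmul, ← h]; abel
    push Not at h1 h2 h3
    rw [h1, h2, h3] at hx
    simp at hx

theorem exists_sum_of_coeff_prod_ne_zero {ι : Type*} {β : ℝ} {v : ι → ℝ} {J : ℕ} (S : Finset ι) :
    ∀ {x : ℝ}, (∏ i ∈ S, (lazyStep β (v i)) ^ J).coeff x ≠ 0 →
      ∃ y : ι → ℤ, (∀ i, |y i| ≤ J) ∧ x = ∑ i ∈ S, (y i : ℝ) * v i := by
  induction S using Finset.induction_on with
  | empty =>
    intro x hx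
    refine ⟨0, by simp, ?_⟩
    rw [Finset.prod_empty, AddMonoidAlgebra.one_def, AddMonoidAlgebra.coeff_single,
      Finsupp.single_apply] at hx
    have : (0 : ℝ) = x := by by_contra h; exact hx (if_neg h)
    simp [this]
  | insert i S hi ih =>
    intro x hx
    rw [Finset.prod_insert hi, coeff_mul_eq_sum] at hx
    obtain ⟨u, -, hu⟩ := Finset.exists_ne_zero_of_sum_ne_zero hx
    obtain ⟨z, hz, hzu⟩ := exists_zsmul_of_coeff_lazyStep_pow_ne_zero (left_ne_zero_of_mul hu)
    obtain ⟨y, hy, hxy⟩ := ih (right_ne_zero_of_mul hu)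
    refine ⟨Function.update y i z, fun j => ?_, ?_⟩
    · by_cases h : j = i
      · subst h; simpa using hz
      · simpa [Function.update_of_ne h] using hy j
    · rw [Finset.sum_insert hi, Function.update_self, ← sub_eq_iff_eq_add', ← zsmul_eq_mul, ← hzu,
        hxy]
      refine Finset.sum_congr rfl fun j hj => ?_
      rw [Function.update_of_ne (by rintro rfl; exact hi hj)]

theorem coeff_mul_mapDomain (F : AddMonoidAlgebra ℝ H) (φ : G →+ H) (P : AddMonoidAlgebra ℝ G)
    (x : H) : (F * AddMonoidAlgebra.mapDomainRingHom ℝ φ P).coeff x =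
      P.coeff.sum fun y p => p * F.coeff (x - φ y) := by
  induction P using AddMonoidAlgebra.induction_linear with
  | zero => simp
  | add P Q hP hQ =>
    rw [map_add, mul_add, AddMonoidAlgebra.coeff_add, AddMonoidAlgebra.coeff_add,
      Finsupp.add_apply, hP, hQ,
      Finsupp.sum_add_index' (by simp) (by intros; ring)]
  | single y p =>
    rw [AddMonoidAlgebra.mapDomainRingHom_apply, AddMonoidAlgebra.mapDomain_single,
      AddMonoidAlgebra.coeff_mul_single_apply, AddMonoidAlgebra.coeff_single,
      Finsupp.sum_single_index (by simp), mul_comm, sub_eq_add_neg]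

theorem coeff_mul_lazyStep_pow_le {β : ℝ} (hβ : 0 ≤ β) (hβ' : β ≤ 1 / 2)
    {F : AddMonoidAlgebra ℝ ℝ} {B X : ℝ} (hF : ∀ x, 0 ≤ F.coeff x) (hB : ∀ x, F.coeff x ≤ B)
    {v : ℝ} {J q : ℕ}
    (hX : ∀ x : ZMod q, ((lazyStep β (1 : ZMod q)) ^ J).coeff x ≤ X)
    (hq : ∀ x : ℝ, ∀ y y' : ℤ, |y| ≤ J → |y'| ≤ J → F.coeff (x - y * v) ≠ 0 →
      F.coeff (x - y' * v) ≠ 0 → (q : ℤ) ∣ y - y') (x : ℝ) :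
    (F * (lazyStep β v) ^ J).coeff x ≤ B * X := by
  have hB0 : 0 ≤ B := (hF 0).trans (hB 0)
  have hX0 : 0 ≤ X := (((isSymmDist_lazyStep hβ hβ' (1 : ZMod q)).pow J).nonneg 0).trans (hX 0)
  set P : AddMonoidAlgebra ℝ ℤ := (lazyStep β (1 : ℤ)) ^ J with hP
  have hPd : IsSymmDist P := (isSymmDist_lazyStep hβ hβ' (1 : ℤ)).pow J
  have h1 : (lazyStep β v) ^ J =
      AddMonoidAlgebra.mapDomainRingHom ℝ (zmultiplesHom ℝ v) P := by
    rw [hP, map_pow, mapDomain_lazyStep]; simp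
  have h2 : (lazyStep β (1 : ZMod q)) ^ J =
      AddMonoidAlgebra.mapDomainRingHom ℝ (zmultiplesHom (ZMod q) 1) P := by
    rw [hP, map_pow, mapDomain_lazyStep]; simp
  have hPs : ∀ y ∈ P.coeff.support, |y| ≤ J := by
    intro y hy
    obtain ⟨z, hz, rfl⟩ := exists_zsmul_of_coeff_lazyStep_pow_ne_zero
      (Finsupp.mem_support_iff.1 hy)
    simpa using hz
  rw [h1, coeff_mul_mapDomain, Finsupp.sum]
  by_cases hall : ∀ y ∈ P.coeff.support, F.coeff (x - y * v) = 0
  · rw [Finset.sum_eq_zero]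
    · positivity
    · intro y hy; simp [hall y hy]
  push Not at hall
  obtain ⟨y₀, hy₀, hne⟩ := hall
  have h3 := hX (y₀ : ZMod q)
  rw [h2, ← one_mul (AddMonoidAlgebra.mapDomainRingHom ℝ _ P), coeff_mul_mapDomain,
    Finsupp.sum] at h3
  refine le_trans ?_ (mul_le_mul_of_nonneg_left h3 hB0)
  rw [Finset.mul_sum]
  refine Finset.sum_le_sum fun y hy => ?_
  have hp := hPd.nonneg y
  have e : (zmultiplesHom ℝ v) y = y * v := by simp
  rw [e]
  by_cases h : F.coeff (x - y * v) = 0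
  · rw [h, mul_zero]
    exact mul_nonneg hB0 (mul_nonneg hp (IsSymmDist.one.nonneg _))
  · have hd := hq x y₀ y (hPs _ hy₀) (hPs _ hy) hne h
    have : ((y₀ - y : ℤ) : ZMod q) = 0 := (ZMod.intCast_zmod_eq_zero_iff_dvd _ _).2 hd
    have h4 : (y₀ : ZMod q) - (zmultiplesHom (ZMod q) 1) y = 0 := by
      simpa using this
    rw [h4, AddMonoidAlgebra.one_def, AddMonoidAlgebra.coeff_single, Finsupp.single_eq_same,
      mul_one, mul_comm]
    exact mul_le_mul_of_nonneg_right (hB _) hp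

end

section

theorem le_rpow_of_pow_mul_le_one {x K : ℝ} {N : ℕ} (hN : N ≠ 0) (hx : 0 ≤ x) (hK : 0 < K)
    (h : x ^ N * K ≤ 1) : x ≤ (1 / K) ^ (N : ℝ)⁻¹ := by
  rw [← Real.pow_rpow_inv_natCast hx hN]
  exact Real.rpow_le_rpow (by positivity) ((le_div_iff₀ hK).2 h) (by positivity)

/-- The concentration estimate for steps in cyclic groups of order at most a power of `M`. -/
def CyclicDecay (β : ℝ) (M : ℕ) : Prop :=
  ∀ B : ℕ, 1 ≤ B → ∀ q : ℕ, 2 ≤ q → q ≤ M ^ B → ∀ x : ZMod q,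
    ((lazyStep β (1 : ZMod q)) ^ M).coeff x ^ (16 * B) * q ≤ 1

theorem CyclicDecay.coeff_mul_le {β : ℝ} {M : ℕ} (hM : CyclicDecay β M) (hβ : 0 ≤ β)
    (hβ' : β ≤ 1 / 2) {B : ℕ} (hB : 1 ≤ B) {q : ℕ} (hq2 : 2 ≤ q) (hqM : q ≤ M ^ B)
    {F : AddMonoidAlgebra ℝ ℝ} (hF : IsSymmDist F) {K : ℝ} (hK : 0 < K)
    (hFK : ∀ x, F.coeff x ^ (16 * B) * K ≤ 1) {v : ℝ}
    (hq : ∀ x : ℝ, ∀ y y' : ℤ, |y| ≤ M → |y'| ≤ M → F.coeff (x - y * v) ≠ 0 →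
      F.coeff (x - y' * v) ≠ 0 → (q : ℤ) ∣ y - y') (x : ℝ) :
    (F * (lazyStep β v) ^ M).coeff x ^ (16 * B) * (K * q) ≤ 1 := by
  have hN : 16 * B ≠ 0 := by omega
  have hq0 : (0 : ℝ) < q := by positivity
  have h := coeff_mul_lazyStep_pow_le hβ hβ' hF.nonneg
    (fun x => le_rpow_of_pow_mul_le_one hN (hF.nonneg x) hK (hFK x))
    (fun x => le_rpow_of_pow_mul_le_one hN
      (((isSymmDist_lazyStep hβ hβ' (1 : ZMod q)).pow M).nonneg x) hq0 (hM B hB q hq2 hqM x))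
    hq x
  have h0 := (hF.mul ((isSymmDist_lazyStep hβ hβ' v).pow M)).nonneg x
  calc _ ≤ ((1 / K) ^ ((16 * B : ℕ) : ℝ)⁻¹ * (1 / (q : ℝ)) ^ ((16 * B : ℕ) : ℝ)⁻¹) ^ (16 * B)
        * (K * q) := by gcongr
    _ = 1 := by
      rw [mul_pow, Real.rpow_inv_natCast_pow (by positivity) hN,
        Real.rpow_inv_natCast_pow (by positivity) hN]
      field_simp

variable {ι : Type*}

/-- `v` has no nontrivial integer relation on `S` with coefficients bounded by `κ`. -/
def Dissoc (κ : ℕ) (v : ι → ℝ) (S : Finset ι) : Prop :=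
  ∀ m : ι → ℤ, (∀ i ∈ S, |m i| ≤ κ) → ∑ i ∈ S, (m i : ℝ) * v i = 0 → ∀ i ∈ S, m i = 0

/-- The product over `S` of the `M`-th powers of the lazy steps along `v`. -/
def walk (β : ℝ) (M : ℕ) (v : ι → ℝ) (S : Finset ι) : AddMonoidAlgebra ℝ ℝ :=
  ∏ i ∈ S, (lazyStep β (v i)) ^ M

theorem isSymmDist_walk {β : ℝ} (hβ : 0 ≤ β) (hβ' : β ≤ 1 / 2) (M : ℕ) (v : ι → ℝ)
    (S : Finset ι) : IsSymmDist (walk β M v S) :=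
  IsSymmDist.prod _ fun i => (isSymmDist_lazyStep hβ hβ' (v i)).pow M

theorem walk_insert (β : ℝ) (M : ℕ) (v : ι → ℝ) {S : Finset ι} {i : ι} (hi : i ∉ S) :
    walk β M v (insert i S) = walk β M v S * (lazyStep β (v i)) ^ M := by
  rw [walk, Finset.prod_insert hi, mul_comm, walk]

theorem walk_relation {β : ℝ} {M : ℕ} {v : ι → ℝ} {S : Finset ι} {u x : ℝ} {y y' : ℤ}
    (h : (walk β M v S).coeff (x - y * u) ≠ 0) (h' : (walk β M v S).coeff (x - y' * u) ≠ 0) :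
    ∃ m : ι → ℤ, (∀ i, |m i| ≤ 2 * M) ∧
      ∑ i ∈ S, (m i : ℝ) * v i = ((y' - y : ℤ) : ℝ) * u := by
  obtain ⟨z, hz, hxz⟩ := exists_sum_of_coeff_prod_ne_zero S h
  obtain ⟨z', hz', hxz'⟩ := exists_sum_of_coeff_prod_ne_zero S h'
  refine ⟨fun i => z i - z' i, fun i => ?_, ?_⟩
  · have h1 := hz i
    have h2 := hz' i
    dsimp only
    rw [abs_le] at *
    omega
  · push_cast
    simp_rw [sub_mul, Finset.sum_sub_distrib]
    rw [← hxz, ← hxz']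
    ring

theorem Dissoc.walk_coeff_le {β : ℝ} {M : ℕ} (hM : CyclicDecay β M) (hβ : 0 ≤ β)
    (hβ' : β ≤ 1 / 2) (hM2 : 2 ≤ M) {κ : ℕ} (hκ : 2 * M ≤ κ) {v : ι → ℝ} (S : Finset ι) :
    Dissoc κ v S → ∀ x, (walk β M v S).coeff x ^ 16 * (M : ℝ) ^ S.card ≤ 1 := by
  induction S using Finset.induction_on with
  | empty =>
    intro _ x
    have h := (isSymmDist_walk hβ hβ' M v ∅)
    simpa using pow_le_one₀ (h.nonneg x) (h.coeff_le_one x)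
  | insert i S hi ih =>
    intro hd x
    have hS : Dissoc κ v S := by
      intro m hm h0 j hj
      have := hd (Function.update m i 0) (fun l hl => ?_) ?_ j (Finset.mem_insert_of_mem hj)
      · rwa [Function.update_of_ne (by rintro rfl; exact hi hj)] at this
      · by_cases h : l = i
        · subst h; simp
        · rw [Function.update_of_ne h]
          exact hm l (Finset.mem_of_mem_insert_of_ne hl h)
      · rw [Finset.sum_insert hi, Function.update_self, Int.cast_zero, zero_mul, zero_add, ← h0]
        refine Finset.sum_congr rfl fun l hl => ?_
        rw [Function.update_of_ne (by rintro rfl; exact hi hl)]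
    rw [walk_insert _ _ _ hi, Finset.card_insert_of_notMem hi, pow_succ]
    refine hM.coeff_mul_le hβ hβ' (B := 1) (K := (M : ℝ) ^ S.card) le_rfl hM2 (by simp)
      (isSymmDist_walk hβ hβ' M v S) (by positivity) (by simpa using ih hS)
      (fun x y y' hy hy' h h' => ?_) x
    obtain ⟨m, hm, hrel⟩ := walk_relation h h'
    have := hd (Function.update m i (y - y')) (fun l hl => ?_) ?_ i (Finset.mem_insert_self _ _)
    · rw [Function.update_self] at this
      rw [this]; exact dvd_zero _
    · by_cases hli : l = i
      · subst hli
        rw [Function.update_self]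
        rw [abs_le] at *
        omega
      · rw [Function.update_of_ne hli]
        exact (hm l).trans (by exact_mod_cast hκ)
    · rw [Finset.sum_insert hi, Function.update_self]
      have : ∑ l ∈ S, ((Function.update m i (y - y') l : ℤ) : ℝ) * v l = ∑ l ∈ S, (m l : ℝ) * v l :=
        Finset.sum_congr rfl fun l hl => by
          rw [Function.update_of_ne (by rintro rfl; exact hi hl)]
      rw [this, hrel]
      push_cast
      ring

/-- Every index of `R` is, after multiplication by the minimal denominator `s`, an integer
combination of the indices in `S`. -/
structure IsReduced (k : ℕ) (v : ι → ℝ) (R S : Finset ι) (s : ι → ℕ) (p : ι → ι → ℤ) : Prop where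
  pos : ∀ i, 1 ≤ s i
  le : ∀ i, s i ≤ k
  abs_le : ∀ i w, |p i w| ≤ k
  eq : ∀ i ∈ R, (s i : ℝ) * v i = ∑ w ∈ S, (p i w : ℝ) * v w
  minimal : ∀ i ∈ R, ∀ z : ℤ, (∀ w ∈ S, (s i : ℤ) ∣ z * p i w) → (s i : ℤ) ∣ z

theorem Dissoc.exists_relation {κ k : ℕ} (hk : 1 ≤ k) (hκ : k ≤ κ) {v : ι → ℝ}
    {R S : Finset ι} (hS : Dissoc κ v S)
    (hmax : ∀ i ∈ R, i ∉ S → ¬ Dissoc k v (insert i S)) {i : ι} (hi : i ∈ R) :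
    ∃ s : ℕ, 1 ≤ s ∧ s ≤ k ∧ ∃ p : ι → ℤ, (∀ w ∈ S, |p w| ≤ k) ∧
      (s : ℝ) * v i = ∑ w ∈ S, (p w : ℝ) * v w := by
  by_cases hiS : i ∈ S
  · refine ⟨1, le_rfl, hk, Pi.single i 1, fun w _ => ?_, ?_⟩
    · by_cases h : w = i
      · subst h; simpa using hk
      · simp [Pi.single_eq_of_ne h]
    · rw [Finset.sum_eq_single i]
      · simp
      · intro w _ h; simp [Pi.single_eq_of_ne h]
      · intro h; exact absurd hiS h
  · have h := hmax i hi hiS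
    unfold Dissoc at h
    push Not at h
    obtain ⟨m, hm, hrel, j, hj, hne⟩ := h
    rw [Finset.sum_insert hiS] at hrel
    have hmi : m i ≠ 0 := by
      intro h0
      rw [h0, Int.cast_zero, zero_mul, zero_add] at hrel
      rcases Finset.mem_insert.1 hj with rfl | hj
      · exact hne h0
      · exact hne (hS m (fun l hl => (hm l (Finset.mem_insert_of_mem hl)).trans
          (by exact_mod_cast hκ)) hrel j hj)
    refine ⟨(m i).natAbs, Int.natAbs_pos.2 hmi, ?_, fun w => -(m i).sign * m w, fun w hw => ?_, ?_⟩
    · have := hm i (Finset.mem_insert_self _ _)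
      zify
      exact this
    · rw [abs_mul, abs_neg, Int.abs_sign_of_ne_zero hmi, one_mul]
      exact hm w (Finset.mem_insert_of_mem hw)
    · have e : ((m i).natAbs : ℝ) = ((m i).sign : ℝ) * (m i : ℝ) := by
        rw [Nat.cast_natAbs, ← Int.sign_mul_self_eq_abs]
        push_cast; ring
      push_cast
      simp_rw [mul_assoc]
      rw [← Finset.mul_sum, e]
      linear_combination ((m i).sign : ℝ) * hrel

theorem Dissoc.exists_isReduced {κ k : ℕ} (hk : 1 ≤ k) (hκ : k ≤ κ) {v : ι → ℝ}
    {R S : Finset ι} (hS : Dissoc κ v S)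
    (hmax : ∀ i ∈ R, i ∉ S → ¬ Dissoc k v (insert i S)) :
    ∃ s p, IsReduced k v R S s p := by
  have key : ∀ i, ∃ (s : ℕ) (p : ι → ℤ), 1 ≤ s ∧ s ≤ k ∧ (∀ w, |p w| ≤ k) ∧
      (i ∈ R → (s : ℝ) * v i = ∑ w ∈ S, (p w : ℝ) * v w) ∧
      (i ∈ R → ∀ z : ℤ, (∀ w ∈ S, (s : ℤ) ∣ z * p w) → (s : ℤ) ∣ z) := by
    intro i
    by_cases hi : i ∈ R
    swap
    · exact ⟨1, 0, le_rfl, hk, by simp, fun h => absurd h hi, fun h => absurd h hi⟩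
    have hex := hS.exists_relation hk hκ hmax hi
    obtain ⟨h1, hsk, p, hp, he⟩ := Nat.find_spec hex
    have hmin := fun n => Nat.find_min' hex (m := n)
    set s := Nat.find hex with hs
    refine ⟨s, fun w => if w ∈ S then p w else 0, h1, hsk, fun w => ?_, fun _ => ?_,
      fun _ z hz => ?_⟩
    · dsimp only
      split_ifs with h
      · exact hp w h
      · simp
    · rw [he]
      exact Finset.sum_congr rfl fun w hw => by dsimp only; rw [if_pos hw]
    · have hs0 : (s : ℤ) ≠ 0 := by omega
      set g := Int.gcd s z with hg
      have hg0 : 0 < g := Int.gcd_pos_of_ne_zero_left _ hs0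
      have hgs : (g : ℤ) ∣ s := Int.gcd_dvd_left _ _
      have hdvd : ∀ w ∈ S, (s : ℤ) ∣ g * p w := by
        intro w hw
        have := hz w hw
        dsimp only at this
        rw [if_pos hw] at this
        rw [hg, Int.gcd_eq_gcd_ab, add_mul]
        refine dvd_add ⟨Int.gcdA s z * p w, by ring⟩ ?_
        rw [mul_right_comm]
        exact this.mul_right _
      have hgle : g ≤ s := Nat.le_of_dvd h1 (by exact_mod_cast hgs)
      have := hmin g ⟨hg0, hgle.trans hsk, fun w => g * p w / s, fun w hw => ?_, ?_⟩
      · have : g = s := le_antisymm hgle this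
        rw [← this]
        exact Int.gcd_dvd_right _ _
      · obtain ⟨c, hc⟩ := hdvd w hw
        show |(g : ℤ) * p w / s| ≤ k
        rw [hc, Int.mul_ediv_cancel_left _ hs0]
        refine le_trans ?_ (hp w hw)
        have h2 : (s : ℤ) * |c| ≤ s * |p w| := by
          rw [← Nat.abs_cast s, ← abs_mul, ← hc, abs_mul, Nat.abs_cast, Nat.abs_cast]
          exact mul_le_mul_of_nonneg_right (by exact_mod_cast hgle) (abs_nonneg _)
        exact le_of_mul_le_mul_left h2 (by omega)
      · have hsr : (s : ℝ) ≠ 0 := by exact_mod_cast hs0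
        apply mul_left_cancel₀ hsr
        rw [mul_left_comm, he, Finset.mul_sum, Finset.mul_sum]
        refine Finset.sum_congr rfl fun w hw => ?_
        obtain ⟨c, hc⟩ := hdvd w hw
        dsimp only
        rw [hc, Int.mul_ediv_cancel_left _ hs0, ← mul_assoc, ← mul_assoc]
        congr 1
        exact_mod_cast hc
  choose s p h using key
  exact ⟨s, p, fun i => (h i).1, fun i => (h i).2.1, fun i => (h i).2.2.1,
    fun i => (h i).2.2.2.1, fun i => (h i).2.2.2.2⟩

end

section

variable {ι : Type*}

theorem IsReduced.extend {β : ℝ} {M : ℕ} (hM : CyclicDecay β M) (hβ : 0 ≤ β)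
    (hβ' : β ≤ 1 / 2) {B H κ : ℕ} (hB : 1 ≤ B) {v : ι → ℝ} {R S : Finset ι}
    {s : ι → ℕ} {p : ι → ι → ℤ} (hred : IsReduced (M ^ B) v R S s p) (hd : Dissoc κ v S)
    (hκ : 2 * M * (H * M ^ B) * M ^ B * (M + 1) ≤ κ)
    {S' : Finset ι} (hS'R : S' ⊆ R) (hcard : S'.card ≤ M) {K : ℕ} (hK : 1 ≤ K) (hKH : K ≤ H)
    (hdiv : ∀ i ∈ S', s i ∣ K) (hF : ∀ x, (walk β M v S').coeff x ^ (16 * B) * (K : ℝ) ≤ 1)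
    {u : ι} (hu : u ∈ R) (hndvd : ¬ s u ∣ K) :
    ∃ K' : ℕ, 2 * K ≤ K' ∧ K' ≤ H * M ^ B ∧ (∀ i ∈ insert u S', s i ∣ K') ∧
      ∀ x, (walk β M v (insert u S')).coeff x ^ (16 * B) * (K' : ℝ) ≤ 1 := by
  have huS' : u ∉ S' := fun h => hndvd (hdiv u h)
  set k := M ^ B with hk
  obtain ⟨t, ρ, hcop, hKt, hsρ⟩ := Nat.exists_coprime K (s u)
  set g := Nat.gcd K (s u) with hg
  have hsu := hred.pos u
  have hg0 : 0 < g := Nat.gcd_pos_of_pos_left _ hK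
  have hρ0 : 0 < ρ := Nat.pos_of_ne_zero (by rintro rfl; omega)
  have hρ2 : 2 ≤ ρ := by
    by_contra h
    have : ρ = 1 := by omega
    rw [this, one_mul] at hsρ
    exact hndvd (hsρ ▸ Nat.gcd_dvd_left _ _)
  have hρk : ρ ≤ k := by
    refine le_trans ?_ (hred.le u)
    rw [hsρ]
    exact Nat.le_mul_of_pos_right _ hg0
  have htH : t ≤ H := by
    refine le_trans ?_ hKH
    rw [hKt]
    exact Nat.le_mul_of_pos_right _ hg0
  refine ⟨K * ρ, by nlinarith, Nat.mul_le_mul hKH hρk, fun i hi => ?_, ?_⟩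
  · rcases Finset.mem_insert.1 hi with rfl | hi
    · exact ⟨t, by rw [hKt, hsρ]; ring⟩
    · exact (hdiv i hi).mul_right _
  intro x
  rw [walk_insert _ _ _ huS', Nat.cast_mul]
  refine hM.coeff_mul_le hβ hβ' hB hρ2 hρk (isSymmDist_walk hβ hβ' M v S')
    (by positivity) hF (fun x y y' hy hy' h h' => ?_) x
  obtain ⟨m, hm, hrel⟩ := walk_relation h h'
  set Δ := y' - y with hΔ
  have hΔM : |Δ| ≤ 2 * M := by rw [_root_.abs_le] at hy hy' ⊢; omega
  obtain ⟨e, he⟩ : ∃ e : ι → ℕ, ∀ i ∈ S', e i * s i = K ∧ e i ≤ K :=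
    ⟨fun i => K / s i, fun i hi => ⟨Nat.div_mul_cancel (hdiv i hi), Nat.div_le_self _ _⟩⟩
  set n : ι → ℤ := fun w => ∑ i ∈ S', m i * ρ * e i * p i w - Δ * t * p u w with hn
  have hnw : ∀ w ∈ S, n w = 0 := by
    refine hd n (fun w _ => ?_) ?_
    · have h1 : |∑ i ∈ S', m i * ρ * e i * p i w| ≤
          ∑ i ∈ S', (2 * M * k * H * k : ℤ) := by
        refine (Finset.abs_sum_le_sum_abs _ _).trans (Finset.sum_le_sum fun i hi => ?_)
        rw [abs_mul, abs_mul, abs_mul, Nat.abs_cast, Nat.abs_cast]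
        have h3 : (e i : ℤ) ≤ H := by exact_mod_cast (he i hi).2.trans hKH
        gcongr
        · exact hm i
        · exact hred.abs_le i w
      have h2 : |Δ * t * p u w| ≤ 2 * M * H * k := by
        rw [abs_mul, abs_mul, Nat.abs_cast]
        gcongr
        exact hred.abs_le u w
      rw [Finset.sum_const, nsmul_eq_mul] at h1
      have h3 : (S'.card : ℤ) * (2 * M * k * H * k) ≤ M * (2 * M * k * H * k) := by gcongr
      have h4 : (2 * M * H * k : ℤ) ≤ 2 * M * H * k * k := by
        refine le_mul_of_one_le_right (by positivity) ?_
        exact_mod_cast (by omega : 1 ≤ k)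
      have h5 : (2 * M * (H * k) * k * (M + 1) : ℤ) ≤ κ := by exact_mod_cast hκ
      have := abs_sub (∑ i ∈ S', m i * ρ * e i * p i w) (Δ * t * p u w)
      calc |n w| ≤ _ := this
        _ ≤ (κ : ℤ) := by nlinarith
    · have e1 : ∀ i ∈ S', (e i : ℝ) * (s i : ℝ) = K := fun i hi => by
        exact_mod_cast (he i hi).1
      have e2 : (K : ℝ) * ρ = t * s u := by
        rw [hKt, hsρ]; push_cast; ring
      have e3 : ∑ w ∈ S, ((∑ i ∈ S', m i * ρ * e i * p i w : ℤ) : ℝ) * v w =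
          K * ρ * ∑ i ∈ S', (m i : ℝ) * v i := by
        push_cast
        simp_rw [Finset.sum_mul]
        rw [Finset.sum_comm, Finset.mul_sum]
        refine Finset.sum_congr rfl fun i hi => ?_
        rw [← e1 i hi]
        calc _ = m i * ρ * e i * ∑ w ∈ S, (p i w : ℝ) * v w := by
              rw [Finset.mul_sum]
              exact Finset.sum_congr rfl fun w _ => by ring
          _ = _ := by rw [← hred.eq i (hS'R hi)]; ring
      have e4 : ∑ w ∈ S, ((Δ * t * p u w : ℤ) : ℝ) * v w = Δ * t * (s u * v u) := by
        rw [hred.eq u hu, Finset.mul_sum]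
        exact Finset.sum_congr rfl fun w _ => by push_cast; ring
      simp only [hn]
      simp_rw [Int.cast_sub, sub_mul, Finset.sum_sub_distrib]
      rw [e3, e4, hrel, e2, hΔ]
      push_cast
      ring
  have hρΔ : ∀ w ∈ S, (ρ : ℤ) ∣ Δ * p u w := by
    intro w hw
    have h1 : Δ * t * p u w = ∑ i ∈ S', m i * ρ * e i * p i w :=
      (sub_eq_zero.1 (hnw w hw)).symm
    have h2 : (ρ : ℤ) ∣ t * (Δ * p u w) := by
      rw [show (t : ℤ) * (Δ * p u w) = Δ * t * p u w by ring, h1]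
      exact Finset.dvd_sum fun i _ => ⟨m i * e i * p i w, by ring⟩
    exact (Int.isCoprime_iff_gcd_eq_one.2 (by simpa using hcop.symm) : IsCoprime (ρ : ℤ) t)
      |>.dvd_of_dvd_mul_left h2
  have h1 : (s u : ℤ) ∣ g * Δ := by
    refine hred.minimal u hu _ fun w hw => ?_
    obtain ⟨c, hc⟩ := hρΔ w hw
    refine ⟨c, ?_⟩
    rw [hsρ, mul_assoc, hc]
    push_cast
    ring
  rw [hsρ, Nat.cast_mul, mul_comm (ρ : ℤ)] at h1
  have h2 := Int.dvd_of_mul_dvd_mul_left (by exact_mod_cast hg0.ne') h1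
  rw [← neg_sub, dvd_neg]
  exact h2

/-- All steps indexed by few elements of `R` return to the origin with large probability. -/
def IsGood (β : ℝ) (M D : ℕ) (v : ι → ℝ) (R : Finset ι) : Prop :=
  ∀ S ⊆ R, S.card ≤ M → 1 ≤ (walk β M v S).coeff 0 * (M : ℝ) ^ D

theorem IsGood.le_of_coeff_pow_mul_le {β : ℝ} {M D : ℕ} {v : ι → ℝ} {R : Finset ι}
    (hR : IsGood β M D v R) {S : Finset ι} (hS : S ⊆ R) (hc : S.card ≤ M) {N K : ℕ}
    (h : (walk β M v S).coeff 0 ^ N * (K : ℝ) ≤ 1) : K ≤ M ^ (N * D) := by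
  have h1 := one_le_pow₀ (n := N) (hR S hS hc)
  rw [mul_pow, ← pow_mul, mul_comm D] at h1
  have h2 : (K : ℝ) ≤ (M : ℝ) ^ (N * D) := by
    calc (K : ℝ) = 1 * K := (one_mul _).symm
      _ ≤ ((walk β M v S).coeff 0 ^ N * (M : ℝ) ^ (N * D)) * K := by gcongr
      _ = ((walk β M v S).coeff 0 ^ N * K) * (M : ℝ) ^ (N * D) := by ring
      _ ≤ 1 * (M : ℝ) ^ (N * D) := by gcongr
      _ = _ := one_mul _
  exact_mod_cast h2

theorem IsReduced.exists_common_multiple {β : ℝ} {M : ℕ} (hM : CyclicDecay β M) (hβ : 0 ≤ β)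
    (hβ' : β ≤ 1 / 2) (hM2 : 2 ≤ M) {B D κ : ℕ} (hB : 1 ≤ B) {v : ι → ℝ} {R S : Finset ι}
    {s : ι → ℕ} {p : ι → ι → ℤ} (hred : IsReduced (M ^ B) v R S s p) (hd : Dissoc κ v S)
    (hκ : 2 * M * (M ^ (16 * B * D) * M ^ B) * M ^ B * (M + 1) ≤ κ)
    (hR : IsGood β M D v R) (hlt : M ^ (16 * B * D) * M ^ B < 2 ^ M) :
    ∃ K, 1 ≤ K ∧ K ≤ M ^ (16 * B * D) ∧ ∀ i ∈ R, s i ∣ K := by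
  by_contra hcon
  push Not at hcon
  set H := M ^ (16 * B * D) with hH
  have hk1 : 1 ≤ M ^ B := Nat.one_le_pow _ _ (by omega)
  have key : ∀ n : ℕ, ∃ (S' : Finset ι) (K : ℕ), S' ⊆ R ∧ S'.card = n ∧ 2 ^ n ≤ K ∧
      K ≤ H ∧ (∀ i ∈ S', s i ∣ K) ∧ ∀ x, (walk β M v S').coeff x ^ (16 * B) * (K : ℝ) ≤ 1 := by
    intro n
    induction n with
    | zero =>
      refine ⟨∅, 1, by simp, by simp, by simp, Nat.one_le_pow _ _ (by omega), by simp, fun x => ?_⟩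
      have h := (isSymmDist_walk hβ hβ' M v ∅)
      simpa using pow_le_one₀ (h.nonneg x) (h.coeff_le_one x)
    | succ n ih =>
      obtain ⟨S', K, hS'R, hn, hnK, hKH, hdiv, hF⟩ := ih
      have hlt' : ∀ {n K : ℕ}, 2 ^ n ≤ K → K ≤ H * M ^ B → n ≤ M := fun h1 h2 =>
        (Nat.pow_lt_pow_iff_right (by norm_num)).1 ((h1.trans h2).trans_lt hlt) |>.le
      have hK1 : 1 ≤ K := (Nat.one_le_two_pow).trans hnK
      obtain ⟨u, hu, hndvd⟩ := hcon K hK1 hKH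
      have huS' : u ∉ S' := fun h => hndvd (hdiv u h)
      obtain ⟨K', h2K, hK'H, hdiv', hF'⟩ := hred.extend hM hβ hβ' hB hd hκ hS'R
        (hn ▸ hlt' hnK (hKH.trans (Nat.le_mul_of_pos_right _ hk1))) hK1 hKH hdiv hF hu hndvd
      have hnK' : 2 ^ (n + 1) ≤ K' := by rw [pow_succ]; omega
      have hcard : (insert u S').card = n + 1 := by
        rw [Finset.card_insert_of_notMem huS', hn]
      exact ⟨insert u S', K', Finset.insert_subset hu hS'R, hcard, hnK',
        hR.le_of_coeff_pow_mul_le (Finset.insert_subset hu hS'R) (hcard ▸ hlt' hnK' hK'H) (hF' 0),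
        hdiv', hF'⟩
  obtain ⟨S', K, -, -, h1, h2, -, -⟩ := key M
  have := Nat.le_mul_of_pos_right H hk1
  omega

/-- The exponents of the dissociativity scales. -/
def scaleExp (D : ℕ) : ℕ → ℕ
  | 0 => 2
  | j + 1 => (16 * D + 2) * scaleExp D j + 4

theorem scaleExp_mono (D : ℕ) : Monotone (scaleExp D) :=
  monotone_nat_of_le_succ fun j => by rw [scaleExp]; nlinarith [Nat.zero_le (D * scaleExp D j)]

theorem two_le_scaleExp (D j : ℕ) : 2 ≤ scaleExp D j := scaleExp_mono D (Nat.zero_le j)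

theorem IsGood.exists_dissoc {β : ℝ} {M D : ℕ} (hM : CyclicDecay β M) (hβ : 0 ≤ β)
    (hβ' : β ≤ 1 / 2) (hM2 : 2 ≤ M) (hDM : 16 * D + 1 ≤ M) {v : ι → ℝ} {R : Finset ι}
    (hR : IsGood β M D v R) :
    ∃ B, 1 ≤ B ∧ B ≤ scaleExp D (16 * D + 1) ∧ ∃ S ⊆ R, S.card ≤ 16 * D ∧
      Dissoc (M ^ ((16 * D + 2) * B + 4)) v S ∧
      ∀ i ∈ R, i ∉ S → ¬ Dissoc (M ^ B) v (insert i S) := by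
  by_contra hcon
  push Not at hcon
  have key : ∀ d ≤ 16 * D + 1, ∃ S ⊆ R, S.card = d ∧
      Dissoc (M ^ scaleExp D (16 * D + 1 - d)) v S := by
    intro d
    induction d with
    | zero => exact fun _ => ⟨∅, by simp, by simp, by simp [Dissoc]⟩
    | succ d ih =>
      intro hd
      obtain ⟨S, hSR, hc, hS⟩ := ih (by omega)
      have e : 16 * D + 1 - d = (16 * D + 1 - (d + 1)) + 1 := by omega
      rw [e, scaleExp] at hS
      obtain ⟨i, hi, hiS, h⟩ := hcon (scaleExp D (16 * D + 1 - (d + 1)))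
        (one_le_two.trans (two_le_scaleExp _ _)) (scaleExp_mono D (by omega)) S hSR (by omega) hS
      exact ⟨insert i S, Finset.insert_subset hi hSR, by
        rw [Finset.card_insert_of_notMem hiS, hc], h⟩
  obtain ⟨S, hSR, hc, hS⟩ := key _ le_rfl
  have hκ : 2 * M ≤ M ^ scaleExp D (16 * D + 1 - (16 * D + 1)) :=
    calc 2 * M ≤ M ^ 2 := by nlinarith
      _ ≤ _ := Nat.pow_le_pow_right (by omega) (two_le_scaleExp _ _)
  have h1 := hS.walk_coeff_le hM hβ hβ' hM2 hκ S 0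
  have h2 := hR.le_of_coeff_pow_mul_le (K := M ^ S.card) hSR (by omega) (by exact_mod_cast h1)
  rw [hc] at h2
  have := (Nat.pow_le_pow_iff_right (by omega : 1 < M)).1 h2
  omega

end

section

variable {ι : Type*}

theorem exists_isGood [Fintype ι] {β : ℝ} (hβ : 0 ≤ β) (hβ' : β ≤ 1 / 2) {a D : ℕ} {v : ι → ℝ}
    (h : 1 < ((∏ i, lazyStep β (v i)).coeff 0) ^ 2 * ((2 ^ (a + 1) : ℕ) : ℝ) ^ D) :
    ∃ R, IsGood β (2 ^ (a + 1)) D v R ∧ Rᶜ.card ≤ 2 ^ a * 2 ^ (a + 1) := by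
  set M := 2 ^ (a + 1) with hM
  have hM0 : (0 : ℝ) < M := by positivity
  have hstep := fun i => isSymmDist_lazyStep hβ hβ' (v i)
  have key : ∀ l : ℕ, (∃ R, IsGood β M D v R ∧ Rᶜ.card ≤ l * M) ∨
      ∃ P : Finset (Finset ι), P.card = l ∧ (P : Set (Finset ι)).PairwiseDisjoint id ∧
        ∀ S ∈ P, S.card ≤ M ∧ (walk β M v S).coeff 0 * (M : ℝ) ^ D < 1 := by
    intro l
    induction l with
    | zero => exact Or.inr ⟨∅, by simp, by simp, by simp⟩
    | succ l ih =>
      rcases ih with ⟨R, hR, hc⟩ | ⟨P, hPc, hPd, hP⟩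
      · exact Or.inl ⟨R, hR, hc.trans (Nat.mul_le_mul_right _ (Nat.le_succ _))⟩
      by_cases hR : IsGood β M D v (P.biUnion id)ᶜ
      · refine Or.inl ⟨_, hR, ?_⟩
        rw [compl_compl]
        calc _ ≤ P.card * M := Finset.card_biUnion_le_card_mul _ _ _ fun S hS => (hP S hS).1
          _ ≤ _ := by rw [hPc]; exact Nat.mul_le_mul_right _ (Nat.le_succ _)
      · unfold IsGood at hR
        push Not at hR
        obtain ⟨S, hSR, hSc, hlt⟩ := hR
        have hdisj : ∀ S' ∈ P, Disjoint S S' := fun S' hS' =>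
          Finset.disjoint_left.2 fun x hx hx' =>
            Finset.mem_compl.1 (hSR hx) (Finset.mem_biUnion.2 ⟨S', hS', hx'⟩)
        have hSP : S ∉ P := by
          intro hS
          have : S = ∅ := Finset.disjoint_self_iff_empty S |>.1 (hdisj S hS)
          rw [this, walk, Finset.prod_empty, AddMonoidAlgebra.one_def,
            AddMonoidAlgebra.coeff_single, Finsupp.single_eq_same, one_mul] at hlt
          have : (1 : ℝ) ≤ (M : ℝ) ^ D := one_le_pow₀ (by
            rw [hM]; exact_mod_cast Nat.one_le_two_pow)
          linarith
        refine Or.inr ⟨insert S P, by rw [Finset.card_insert_of_notMem hSP, hPc], ?_, ?_⟩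
        · rw [Finset.coe_insert]
          exact hPd.insert fun S' hS' _ => hdisj S' hS'
        · intro S' hS'
          rcases Finset.mem_insert.1 hS' with rfl | hS'
          · exact ⟨hSc, hlt⟩
          · exact hP S' hS'
  rcases key (2 ^ a) with h1 | ⟨P, hPc, hPd, hP⟩
  · exact h1
  exfalso
  set U := P.biUnion id with hU
  set F : AddMonoidAlgebra ℝ ℝ := ∏ i ∈ U, lazyStep β (v i) with hF
  set G : AddMonoidAlgebra ℝ ℝ := ∏ i ∈ Uᶜ, lazyStep β (v i) with hG
  have hFd : IsSymmDist F := IsSymmDist.prod _ hstep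
  have hGd : IsSymmDist G := IsSymmDist.prod _ hstep
  have e1 : ∏ i, lazyStep β (v i) = F * G := (Finset.prod_mul_prod_compl U _).symm
  have h2 : (F * F).coeff 0 ≤ 1 / (M : ℝ) ^ D := by
    have e2 : F * F = ∏ S ∈ P, (∏ i ∈ S, lazyStep β (v i)) ^ 2 := by
      rw [hF, hU, Finset.prod_biUnion hPd, ← sq, Finset.prod_pow]
      rfl
    rw [e2]
    refine IsSymmDist.coeff_zero_prod_le (by positivity) a P _ hPc
      (fun S => (IsSymmDist.prod S hstep).pow 2) fun S hS => ?_
    rw [← pow_mul, ← Finset.prod_pow, ← pow_succ']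
    exact (le_div_iff₀ (by positivity)).2 (hP S hS).2.le
  have h3 : ((F * G).coeff 0) ^ 2 ≤ 1 / (M : ℝ) ^ D :=
    calc _ ≤ (F * F).coeff 0 * (G * G).coeff 0 := hFd.coeff_mul_sq_le hGd 0
      _ ≤ 1 / (M : ℝ) ^ D * 1 := by
        gcongr
        · exact (hGd.mul hGd).nonneg 0
        · exact (hGd.mul hGd).coeff_le_one 0
      _ = _ := mul_one _
  rw [e1] at h
  have := (le_div_iff₀ (by positivity)).1 h3
  linarith

theorem exists_linear_lt_two_pow (A B : ℕ) : ∃ a₀ : ℕ, ∀ a ≥ a₀, A * (a + 1) + B < 2 ^ (a + 1) := by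
  have h1 := (tendsto_pow_const_div_const_pow_of_one_lt 1 (by norm_num : (1 : ℝ) < 2))
  have h2 := h1.eventually (gt_mem_nhds (show (0 : ℝ) < 1 / (A + B + 1) by positivity))
  obtain ⟨a₀, ha⟩ := Filter.eventually_atTop.1 h2
  refine ⟨a₀, fun a haa => ?_⟩
  have h3 := ha (a + 1) (by omega)
  rw [pow_one, div_lt_div_iff₀ (by positivity) (by positivity), one_mul] at h3
  have h4 : (a + 1) * (A + B + 1) < 2 ^ (a + 1) := by exact_mod_cast h3
  nlinarith

/-- Inverse theorem for linear Littlewood–Offord sums: a non-negligible return probability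
forces all but few coefficients to be combinations, with bounded integer coefficients and
common denominator, of a bounded number of them. -/
theorem exists_linear_inverse (D : ℕ) : ∃ r c a₀ : ℕ, ∀ a ≥ a₀, ∀ β : ℝ, 1 / 8 ≤ β → β ≤ 1 / 4 →
    ∀ {ι : Type} [Fintype ι] [Nonempty ι] (v : ι → ℝ),
      1 < ((∏ i, lazyStep β (v i)).coeff 0) ^ 2 * ((2 ^ (a + 1) : ℕ) : ℝ) ^ D →
      ∃ (w : Fin r → ι) (K : ℕ) (m : ι → Fin r → ℤ) (J : Finset ι),
        1 ≤ K ∧ K ≤ (2 ^ (a + 1)) ^ c ∧ (∀ i l, |m i l| ≤ ((2 ^ (a + 1)) ^ c : ℕ)) ∧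
        J.card ≤ (2 ^ (a + 1)) ^ 2 ∧
        ∀ i, i ∉ J → (K : ℝ) * v i = ∑ l, (m i l : ℝ) * v (w l) := by
  obtain ⟨a₁, ha₁⟩ := exists_coeff_lazyStep_pow_mul_le
  set b := scaleExp D (16 * D + 1) with hb
  obtain ⟨a₂, ha₂⟩ := exists_linear_lt_two_pow ((16 * D + 1) * b) (16 * D + 1)
  refine ⟨16 * D, (16 * D + 1) * b, max a₁ a₂, fun a ha β hβ hβ' ι _ _ v h => ?_⟩
  have hM : CyclicDecay β (2 ^ (a + 1)) := fun B hB q hq hqM x =>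
    ha₁ a (le_trans (le_max_left _ _) ha) β hβ hβ' B hB q hq hqM x
  have haM := ha₂ a (le_trans (le_max_right _ _) ha)
  have hβ0 : 0 ≤ β := by linarith
  have hβ2 : β ≤ 1 / 2 := by linarith
  obtain ⟨R, hR, hRc⟩ := exists_isGood hβ0 hβ2 h
  have e1 : 2 ^ a * 2 ^ (a + 1) ≤ (2 ^ (a + 1)) ^ 2 := by
    rw [sq]
    exact Nat.mul_le_mul_right _ (Nat.pow_le_pow_right (by norm_num) (Nat.le_succ a))
  have hM2 : 2 ≤ 2 ^ (a + 1) := by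
    have := Nat.one_le_two_pow (n := a)
    rw [pow_succ]; omega
  have haM' : (a + 1) * ((16 * D + 1) * b) < 2 ^ (a + 1) := by nlinarith
  set M := 2 ^ (a + 1) with hMdef
  obtain ⟨B, hB1, hBb, S, hSR, hSc, hSd, hSmax⟩ := hR.exists_dissoc hM hβ0 hβ2 hM2
    (le_of_lt (lt_of_le_of_lt (Nat.le_add_left _ _) haM))
  have hMB : 1 ≤ M ^ B := Nat.one_le_pow _ _ (by omega)
  obtain ⟨s, p, hred⟩ := hSd.exists_isReduced hMB
    (Nat.pow_le_pow_right (by omega) (by nlinarith)) hSmax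
  have hexp : 16 * B * D + B ≤ (16 * D + 1) * b :=
    calc 16 * B * D + B = (16 * D + 1) * B := by ring
      _ ≤ _ := Nat.mul_le_mul_left _ hBb
  obtain ⟨K, hK1, hKH, hKdiv⟩ := hred.exists_common_multiple hM hβ0 hβ2 hM2 hB1 hSd (by
      calc _ ≤ 2 * M * (M ^ (16 * B * D) * M ^ B) * M ^ B * (2 * M) := by gcongr; omega
        _ = 2 * 2 * (M * M * (M ^ (16 * B * D) * M ^ B) * M ^ B) := by ring
        _ ≤ M * M * (M * M * (M ^ (16 * B * D) * M ^ B) * M ^ B) := by gcongr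
        _ = _ := by ring) hR (by
      rw [← pow_add]
      calc M ^ (16 * B * D + B) ≤ M ^ ((16 * D + 1) * b) := Nat.pow_le_pow_right (by omega) hexp
        _ = 2 ^ ((a + 1) * ((16 * D + 1) * b)) := by rw [hMdef, ← pow_mul]
        _ < 2 ^ M := Nat.pow_lt_pow_right (by norm_num) haM')
  obtain ⟨e⟩ : Nonempty (S ↪ Fin (16 * D)) := by
    rw [Function.Embedding.nonempty_iff_card_le]
    simpa using hSc
  refine ⟨Function.extend e (fun x => (x : ι)) (fun _ => Classical.arbitrary ι), K,
    fun i => Function.extend e (fun x => ((K / s i : ℕ) : ℤ) * p i x) 0, Rᶜ, hK1,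
    hKH.trans (Nat.pow_le_pow_right (by omega) (le_trans (Nat.le_add_right _ _) hexp)),
    fun i l => ?_, hRc.trans e1, fun i hi => ?_⟩
  · dsimp only
    by_cases hl : ∃ x, e x = l
    · obtain ⟨x, rfl⟩ := hl
      rw [e.injective.extend_apply, abs_mul, Nat.abs_cast]
      calc ((K / s i : ℕ) : ℤ) * |p i x| ≤ ((M ^ (16 * B * D) : ℕ) : ℤ) * ((M ^ B : ℕ) : ℤ) := by
            gcongr
            · exact (Nat.div_le_self _ _).trans hKH
            · exact hred.abs_le i x
        _ = ((M ^ (16 * B * D + B) : ℕ) : ℤ) := by rw [pow_add]; push_cast; ring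
        _ ≤ _ := by exact_mod_cast Nat.pow_le_pow_right (by omega) hexp
    · rw [Function.extend_apply' _ _ _ hl]
      simp
  · rw [Finset.mem_compl, not_not] at hi
    have h1 : (K : ℝ) = (K / s i : ℕ) * (s i : ℕ) := by
      exact_mod_cast (Nat.div_mul_cancel (hKdiv i hi)).symm
    rw [h1, mul_assoc, hred.eq i hi, ← Finset.sum_coe_sort S, Finset.mul_sum]
    refine Fintype.sum_of_injective e e.injective _ _ (fun l hl => ?_) (fun x => ?_)
    · dsimp only
      rw [Function.extend_apply' (fun x : S => ((K / s i : ℕ) : ℤ) * p i x) _ _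
        (by simpa using hl)]
      simp
    · dsimp only
      rw [e.injective.extend_apply, e.injective.extend_apply]
      rw [Int.cast_mul, Int.cast_natCast, mul_assoc]

end

theorem exists_proper_generators (R : ℕ) : ∀ (N : ℕ), 2 ≤ N → ∀ g : Fin R → ℝ,
    ∃ r ≤ R, ∃ (g' : Fin r → ℝ) (N' : ℕ), N' ≤ N ^ 4 ^ R ∧
      (∀ m m' : Fin r → ℤ, (∀ i, |m i| ≤ (N' : ℤ)) → (∀ i, |m' i| ≤ (N' : ℤ)) →
        (∑ i, (m i : ℝ) * g' i) = (∑ i, (m' i : ℝ) * g' i) → m = m') ∧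
      ∀ m : Fin R → ℤ, (∀ i, |m i| ≤ N) → ∃ m' : Fin r → ℤ, (∀ i, |m' i| ≤ N') ∧
        ∑ i, (m i : ℝ) * g i = ∑ i, (m' i : ℝ) * g' i := by
  induction R with
  | zero =>
    intro N hN g
    exact ⟨0, le_rfl, g, N, by simp, fun m m' _ _ _ => Subsingleton.elim _ _,
      fun m hm => ⟨m, hm, rfl⟩⟩
  | succ R ih =>
    intro N hN g
    by_cases hp : ∀ m m' : Fin (R + 1) → ℤ, (∀ i, |m i| ≤ (N : ℤ)) → (∀ i, |m' i| ≤ (N : ℤ)) →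
        (∑ i, (m i : ℝ) * g i) = (∑ i, (m' i : ℝ) * g i) → m = m'
    · exact ⟨R + 1, le_rfl, g, N, Nat.le_self_pow (by positivity) _, hp, fun m hm => ⟨m, hm, rfl⟩⟩
    push Not at hp
    obtain ⟨m, m', hm, hm', heq, hne⟩ := hp
    obtain ⟨i₀, hi₀⟩ := Function.ne_iff.1 hne
    set d : Fin (R + 1) → ℤ := fun i => m i - m' i with hd
    have hdN : ∀ i, |d i| ≤ 2 * N := fun i => by
      have h1 := hm i
      have h2 := hm' i
      simp only [hd]
      rw [abs_le] at h1 h2 ⊢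
      omega
    have hd0 : (d i₀ : ℝ) ≠ 0 := by
      exact_mod_cast sub_ne_zero.2 hi₀
    have hrel : ∑ i, (d i : ℝ) * g i = 0 := by
      simp only [hd, Int.cast_sub, sub_mul, Finset.sum_sub_distrib]
      rw [heq, sub_self]
    rw [Fin.sum_univ_succAbove _ i₀] at hrel
    obtain ⟨r, hr, g', N', hN', hprop, hrep⟩ :=
      ih (N ^ 4) (hN.trans (Nat.le_self_pow (by norm_num) _)) fun j => g (i₀.succAbove j) / d i₀
    refine ⟨r, hr.trans (Nat.le_succ _), g', N', ?_, hprop, fun n hn => ?_⟩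
    · rwa [pow_succ', pow_mul]
    obtain ⟨n', hn', he⟩ := hrep (fun j => n (i₀.succAbove j) * d i₀ - n i₀ * d (i₀.succAbove j))
      fun j => by
        have h1 : |n (i₀.succAbove j) * d i₀| ≤ N * (2 * N) := by
          rw [abs_mul]
          exact mul_le_mul (hn _) (hdN _) (abs_nonneg _) (by positivity)
        have h2 : |n i₀ * d (i₀.succAbove j)| ≤ N * (2 * N) := by
          rw [abs_mul]
          exact mul_le_mul (hn _) (hdN _) (abs_nonneg _) (by positivity)
        have h3 : N * (2 * N) + N * (2 * N) ≤ N ^ 4 := by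
          calc N * (2 * N) + N * (2 * N) = 2 * 2 * (N * N) := by ring
            _ ≤ N * N * (N * N) := by gcongr
            _ = N ^ 4 := by ring
        refine (abs_sub _ _).trans ((add_le_add h1 h2).trans ?_)
        exact_mod_cast h3
    refine ⟨n', hn', ?_⟩
    rw [← he, Fin.sum_univ_succAbove _ i₀]
    have e : ∀ j, ((n (i₀.succAbove j) * d i₀ - n i₀ * d (i₀.succAbove j) : ℤ) : ℝ) *
        (g (i₀.succAbove j) / d i₀) = n (i₀.succAbove j) * g (i₀.succAbove j) -
          n i₀ / d i₀ * (d (i₀.succAbove j) * g (i₀.succAbove j)) := fun j => by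
      push_cast
      field_simp
    simp_rw [e]
    rw [Finset.sum_sub_distrib, ← Finset.mul_sum]
    field_simp
    linear_combination (n i₀ : ℝ) * hrel

theorem exists_proper_gap {R N : ℕ} (hN : 2 ≤ N) (g : Fin R → ℝ) :
    ∃ Q : Set ℝ, IsProperSymGAPSet Q R ((N : ℝ) ^ ((4 ^ R + 2) * R)) ∧
      ∀ m : Fin R → ℤ, (∀ i, |m i| ≤ N) → ∑ i, (m i : ℝ) * g i ∈ Q := by
  obtain ⟨r, hr, g', N', hN', hprop, hrep⟩ := exists_proper_generators R N hN g
  refine ⟨_, ⟨r, g', fun _ => N', hr, rfl, hprop, ?_⟩, fun m hm => hrep m hm⟩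
  have hN2 : (2 : ℝ) ≤ N := by exact_mod_cast hN
  have h1 : 2 * (N' : ℝ) + 1 ≤ (N : ℝ) ^ (4 ^ R + 2) := by
    have h2 : (N' : ℝ) ≤ (N : ℝ) ^ 4 ^ R := by exact_mod_cast hN'
    have h3 : 1 ≤ (N : ℝ) ^ 4 ^ R := one_le_pow₀ (by linarith)
    have h4 : (3 : ℝ) ≤ (N : ℝ) ^ 2 := by nlinarith
    calc 2 * (N' : ℝ) + 1 ≤ (N : ℝ) ^ 4 ^ R * 3 := by linarith
      _ ≤ (N : ℝ) ^ 4 ^ R * (N : ℝ) ^ 2 := by gcongr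
      _ = _ := by rw [← pow_add]
  rw [Finset.prod_const, Finset.card_univ, Fintype.card_fin]
  calc _ ≤ ((N : ℝ) ^ (4 ^ R + 2)) ^ r := by gcongr
    _ ≤ ((N : ℝ) ^ (4 ^ R + 2)) ^ R :=
      pow_le_pow_right₀ (one_le_pow₀ (by linarith)) hr
    _ = _ := by rw [← pow_mul]

section

theorem card_filter_sum_eq_zero {Ω ι : Type*} [Fintype Ω] [Fintype ι] [DecidableEq ι] {β : ℝ}
    {φ : Ω → ℝ}
    (hφ : ∀ b : ℝ, ∑ ω, AddMonoidAlgebra.single (φ ω * b) (1 : ℝ) =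
      (Fintype.card Ω : ℝ) • lazyStep β b) (b : ι → ℝ) :
    ((Finset.univ.filter fun ω : ι → Ω => ∑ j, φ (ω j) * b j = 0).card : ℝ) =
      (Fintype.card Ω : ℝ) ^ Fintype.card ι * (∏ j, lazyStep β (b j)).coeff 0 := by
  have h1 : ∏ j, ((Fintype.card Ω : ℝ) • lazyStep β (b j)) =
      ∑ ω : ι → Ω, AddMonoidAlgebra.single (∑ j, φ (ω j) * b j) (1 : ℝ) := by
    simp_rw [← hφ]
    rw [Finset.prod_univ_sum, Fintype.piFinset_univ]
    refine Finset.sum_congr rfl fun ω _ => ?_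
    rw [AddMonoidAlgebra.prod_single]
    simp
  rw [Finset.prod_smul, Finset.prod_const, Finset.card_univ] at h1
  have h2 := congrArg (fun f => f.coeff 0) h1
  simp only [AddMonoidAlgebra.coeff_smul, Finsupp.smul_apply, smul_eq_mul,
    AddMonoidAlgebra.coeff_sum, Finsupp.finsetSum_apply, AddMonoidAlgebra.coeff_single,
    Finsupp.single_apply] at h2
  rw [h2, Finset.sum_boole]

/-- Half the difference of two signs. -/
def signDiff (y : Bool × Bool) : ℝ := (signv y.1 - signv y.2) / 2

/-- Half the difference of two signs, switched on by a selector bit. -/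
def selDiff (y : Bool × Bool × Bool) : ℝ := if y.1 then signDiff y.2 else 0

theorem sum_single_signDiff (b : ℝ) :
    ∑ ω, AddMonoidAlgebra.single (signDiff ω * b) (1 : ℝ) =
      (Fintype.card (Bool × Bool) : ℝ) • lazyStep (1 / 4) b := by
  rw [Fintype.sum_prod_type]
  simp only [Fintype.sum_bool, signDiff, signv, lazyStep, smul_add, AddMonoidAlgebra.smul_single]
  norm_num
  rw [show (2 : ℝ) = 1 + 1 by norm_num, AddMonoidAlgebra.single_add]
  abel

theorem sum_single_selDiff (b : ℝ) :
    ∑ ω, AddMonoidAlgebra.single (selDiff ω * b) (1 : ℝ) =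
      (Fintype.card (Bool × Bool × Bool) : ℝ) • lazyStep (1 / 8) b := by
  rw [Fintype.sum_prod_type]
  simp only [Fintype.sum_prod_type, Fintype.sum_bool, selDiff, signDiff, signv, lazyStep, smul_add,
    AddMonoidAlgebra.smul_single]
  norm_num
  rw [show (6 : ℝ) = 1 + 1 + 1 + 1 + 1 + 1 by norm_num]
  simp only [AddMonoidAlgebra.single_add]
  abel

theorem sum_sum_pow_four_le {X Y : Type*} [Fintype X] [Fintype Y] (f : X → Y → ℝ) :
    (∑ x, ∑ y, f x y) ^ 4 ≤ (Fintype.card X : ℝ) ^ 2 * (Fintype.card Y : ℝ) ^ 2 *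
      ∑ x, ∑ x', ∑ y, ∑ y', f x y * f x y' * f x' y * f x' y' := by
  have h1 : (∑ x, ∑ y, f x y) ^ 2 ≤ (Fintype.card X : ℝ) * ∑ p : Y × Y, ∑ x, f x p.1 * f x p.2 := by
    have := sq_sum_le_card_mul_sum_sq (s := Finset.univ) (f := fun x => ∑ y, f x y)
    refine this.trans_eq ?_
    rw [Finset.card_univ, Finset.sum_comm]
    congr 1
    refine Finset.sum_congr rfl fun x _ => ?_
    rw [sq, Finset.sum_mul_sum, Fintype.sum_prod_type]
  have h2 := sq_sum_le_card_mul_sum_sq (s := Finset.univ)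
    (f := fun p : Y × Y => ∑ x, f x p.1 * f x p.2)
  have h3 : ∑ p : Y × Y, (∑ x, f x p.1 * f x p.2) ^ 2 =
      ∑ x, ∑ x', ∑ y, ∑ y', f x y * f x y' * f x' y * f x' y' := by
    simp_rw [sq, Finset.sum_mul_sum]
    rw [Finset.sum_comm]
    refine Finset.sum_congr rfl fun x _ => ?_
    rw [Finset.sum_comm]
    refine Finset.sum_congr rfl fun x' _ => ?_
    rw [Fintype.sum_prod_type]
    exact Finset.sum_congr rfl fun y _ => Finset.sum_congr rfl fun y' _ => by ring
  rw [h3, Finset.card_univ, Fintype.card_prod, Nat.cast_mul] at h2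
  calc (∑ x, ∑ y, f x y) ^ 4 = ((∑ x, ∑ y, f x y) ^ 2) ^ 2 := by ring
    _ ≤ ((Fintype.card X : ℝ) * ∑ p : Y × Y, ∑ x, f x p.1 * f x p.2) ^ 2 := by
      gcongr
    _ = (Fintype.card X : ℝ) ^ 2 * (∑ p : Y × Y, ∑ x, f x p.1 * f x p.2) ^ 2 := by ring
    _ ≤ (Fintype.card X : ℝ) ^ 2 * (Fintype.card Y * Fintype.card Y *
        ∑ x, ∑ x', ∑ y, ∑ y', f x y * f x y' * f x' y * f x' y') := by gcongr
    _ = _ := by ring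

variable {n : ℕ}

theorem quadratic_alternating_sum {A : Matrix (Fin n) (Fin n) ℝ} (hA : A.IsSymm)
    (p p' q q' : Fin n → ℝ) :
    (∑ i, ∑ j, A i j * (p i + q i) * (p j + q j)) - (∑ i, ∑ j, A i j * (p i + q' i) * (p j + q' j))
      - (∑ i, ∑ j, A i j * (p' i + q i) * (p' j + q j))
      + (∑ i, ∑ j, A i j * (p' i + q' i) * (p' j + q' j)) =
    2 * ∑ j, (q j - q' j) * ∑ i, A i j * (p i - p' i) := by
  have e : ∑ i, ∑ j, A i j * (q i - q' i) * (p j - p' j) =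
      ∑ j, (q j - q' j) * ∑ i, A i j * (p i - p' i) := by
    refine Finset.sum_congr rfl fun j _ => ?_
    rw [Finset.mul_sum]
    exact Finset.sum_congr rfl fun i _ => by rw [hA.apply]; ring
  have e' : ∑ i, ∑ j, A i j * (p i - p' i) * (q j - q' j) =
      ∑ j, (q j - q' j) * ∑ i, A i j * (p i - p' i) := by
    rw [Finset.sum_comm]
    refine Finset.sum_congr rfl fun j _ => ?_
    rw [Finset.mul_sum]
    exact Finset.sum_congr rfl fun i _ => by ring
  rw [two_mul]
  nth_rw 1 [← e]
  rw [← e']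
  simp only [← Finset.sum_add_distrib, ← Finset.sum_sub_distrib]
  exact Finset.sum_congr rfl fun i _ => Finset.sum_congr rfl fun j _ => by ring

/-- The linear form obtained by decoupling, as a function of the selector and sign bits. -/
def decForm (A : Matrix (Fin n) (Fin n) ℝ) (ω : Fin n → Bool × Bool × Bool) (j : Fin n) : ℝ :=
  ∑ i, selDiff (ω i) * A i j

/-- The decoupled linear form restricted to the unselected indices. -/
def decCoeff (A : Matrix (Fin n) (Fin n) ℝ) (ω : Fin n → Bool × Bool × Bool) (j : Fin n) : ℝ :=
  if (ω j).1 then 0 else decForm A ω j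

/-- Combine two sign vectors according to a selector. -/
def splice (U x y : Fin n → Bool) (i : Fin n) : Bool := if U i then x i else y i

theorem sum_splice (U : Fin n → Bool) (f : (Fin n → Bool) → ℝ) :
    ∑ x, ∑ y, f (splice U x y) = 2 ^ n * ∑ x, f x := by
  have hinv : Function.Involutive fun p : (Fin n → Bool) × (Fin n → Bool) =>
      (splice U p.1 p.2, splice U p.2 p.1) := by
    rintro ⟨x, y⟩
    ext i <;> simp only [splice] <;> split_ifs <;> rfl
  have h := Equiv.sum_comp hinv.toPerm (fun p => f p.1)
  simp only [Function.Involutive.coe_toPerm, Fintype.sum_prod_type] at h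
  rw [h]
  simp [Finset.mul_sum]

theorem decoupling {A : Matrix (Fin n) (Fin n) ℝ} (hA : A.IsSymm) (α : ℝ) :
    (((Finset.univ.filter fun x : Fin n → Bool =>
      ∑ i, ∑ j, A i j * signv (x i) * signv (x j) = α).card : ℝ) / 2 ^ n) ^ 4 * 8 ^ n ≤
    ∑ ω, (∏ j, lazyStep (1 / 4) (decCoeff A ω j)).coeff 0 := by
  set T : (Fin n → Bool) → ℝ := fun x => ∑ i, ∑ j, A i j * signv (x i) * signv (x j) with hT
  set c : ℝ := ((Finset.univ.filter fun x => T x = α).card : ℝ) with hc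
  set f : (Fin n → Bool) → ℝ := fun x => if T x = α then 1 else 0 with hf
  have hfc : ∑ x, f x = c := by rw [hc, hf, Finset.sum_boole]
  set h : (Fin n → Bool) → (Fin n → Bool) → (Fin n → Bool) → ℝ := fun U x x' =>
    4 ^ n * (∏ j, lazyStep (1 / 4) (decCoeff A (fun i => (U i, x i, x' i)) j)).coeff 0 with hh
  have hU : ∀ U, c ^ 4 ≤ ∑ x, ∑ x', h U x x' := by
    intro U
    have h1 := sum_sum_pow_four_le fun x y => f (splice U x y)
    rw [sum_splice, hfc] at h1
    have h2 : ∀ x x', ∑ y, ∑ y', f (splice U x y) * f (splice U x y') * f (splice U x' y) *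
        f (splice U x' y') ≤ h U x x' := by
      intro x x'
      have h3 := card_filter_sum_eq_zero sum_single_signDiff
        (decCoeff A (fun i => (U i, x i, x' i)))
      simp only [Fintype.card_prod, Fintype.card_bool, Fintype.card_fin] at h3
      have h4 : h U x x' = ((Finset.univ.filter fun ω : Fin n → Bool × Bool =>
          ∑ j, signDiff (ω j) * decCoeff A (fun i => (U i, x i, x' i)) j = 0).card : ℝ) := by
        refine Eq.trans ?_ (h3.symm.trans ?_)
        · simp only [hh]; norm_num
        · congr
      rw [h4, ← Finset.sum_boole, ← (Equiv.arrowProdEquivProdArrow (Fin n) (fun _ => Bool)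
        (fun _ => Bool)).symm.sum_comp, Fintype.sum_prod_type]
      refine Finset.sum_le_sum fun y _ => Finset.sum_le_sum fun y' _ => ?_
      by_cases hall : T (splice U x y) = α ∧ T (splice U x y') = α ∧ T (splice U x' y) = α ∧
        T (splice U x' y') = α
      · obtain ⟨e1, e2, e3, e4⟩ := hall
        simp only [hf, if_pos e1, if_pos e2, if_pos e3, if_pos e4]
        rw [if_pos, mul_one, mul_one, mul_one]
        have hs : ∀ x y : Fin n → Bool, T (splice U x y) = ∑ i, ∑ j, A i j *
            ((if U i then signv (x i) else 0) + (if U i then 0 else signv (y i))) *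
            ((if U j then signv (x j) else 0) + (if U j then 0 else signv (y j))) := by
          intro x y
          have : ∀ i, signv (splice U x y i) =
              (if U i then signv (x i) else 0) + (if U i then 0 else signv (y i)) := by
            intro i; simp only [splice]; split_ifs <;> simp
          simp only [hT, this]
        have h5 := quadratic_alternating_sum hA (fun i => if U i then signv (x i) else 0)
          (fun i => if U i then signv (x' i) else 0) (fun i => if U i then 0 else signv (y i))
          (fun i => if U i then 0 else signv (y' i))
        rw [← hs, ← hs, ← hs, ← hs, e1, e2, e3, e4] at h5
        have h6 : ∑ j, signDiff (y j, y' j) * decCoeff A (fun i => (U i, x i, x' i)) j =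
            1 / 4 * ∑ j, ((if U j then 0 else signv (y j)) - (if U j then 0 else signv (y' j))) *
              ∑ i, A i j *
                ((if U i then signv (x i) else 0) - (if U i then signv (x' i) else 0)) := by
          rw [Finset.mul_sum]
          refine Finset.sum_congr rfl fun j _ => ?_
          simp only [decCoeff, decForm, signDiff, selDiff]
          split_ifs
          · simp
          · rw [show ∀ u v w : ℝ, 1 / 4 * ((u - v) * w) = (u - v) / 2 * (1 / 2 * w) by
              intros; ring]
            congr 1
            rw [Finset.mul_sum]
            refine Finset.sum_congr rfl fun i _ => ?_
            split_ifs <;> ring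
        refine h6.trans ?_
        linarith
      · have hz : f (splice U x y) * f (splice U x y') * f (splice U x' y) *
            f (splice U x' y') = 0 := by
          simp only [hf]
          by_contra hne
          apply hall
          simp only [mul_ne_zero_iff, ne_eq, ite_eq_right_iff, one_ne_zero, imp_false,
            not_not] at hne
          tauto
        rw [hz]
        split_ifs <;> norm_num
    have h7 := Finset.sum_le_sum fun x (_ : x ∈ Finset.univ) =>
      Finset.sum_le_sum fun x' (_ : x' ∈ Finset.univ) => h2 x x'
    simp only [Fintype.card_fun, Fintype.card_bool, Fintype.card_fin, Nat.cast_pow,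
      Nat.cast_ofNat] at h1
    have hp : (0 : ℝ) < 2 ^ n := by positivity
    have h8 := h1.trans (mul_le_mul_of_nonneg_left h7 (by positivity))
    have h9 : ((2 : ℝ) ^ n) ^ 4 * c ^ 4 ≤ ((2 : ℝ) ^ n) ^ 4 * ∑ x, ∑ x', h U x x' := by
      calc _ = (2 ^ n * c) ^ 4 := by ring
        _ ≤ _ := h8
        _ = _ := by ring
    exact le_of_mul_le_mul_left h9 (by positivity)
  have hsum : ∑ U, ∑ x, ∑ x', h U x x' =
      4 ^ n * ∑ ω, (∏ j, lazyStep (1 / 4) (decCoeff A ω j)).coeff 0 := by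
    rw [Finset.mul_sum, ← (Equiv.arrowProdEquivProdArrow (Fin n) (fun _ => Bool)
      (fun _ => Bool × Bool)).symm.sum_comp, Fintype.sum_prod_type]
    refine Finset.sum_congr rfl fun U _ => ?_
    rw [← (Equiv.arrowProdEquivProdArrow (Fin n) (fun _ => Bool)
      (fun _ => Bool)).symm.sum_comp, Fintype.sum_prod_type]
    rfl
  have h10 := Finset.sum_le_sum fun U (_ : U ∈ Finset.univ) => hU U
  rw [hsum, Finset.sum_const, Finset.card_univ, Fintype.card_fun, Fintype.card_bool,
    Fintype.card_fin, nsmul_eq_mul] at h10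
  push_cast at h10
  have h4 : (4 : ℝ) ^ n = (2 ^ n) ^ 2 := by rw [← pow_mul, mul_comm, pow_mul]; norm_num
  have h8 : (8 : ℝ) ^ n = (2 ^ n) ^ 3 := by rw [← pow_mul, mul_comm, pow_mul]; norm_num
  have hp : (0 : ℝ) < 2 ^ n := by positivity
  rw [h4] at h10
  rw [h8, div_pow]
  refine le_of_mul_le_mul_left ?_ (show (0 : ℝ) < (2 ^ n) ^ 2 by positivity)
  calc _ = 2 ^ n * c ^ 4 := by field_simp
    _ ≤ _ := h10

end

theorem card_filter_half_le {Ω : Type*} [Fintype Ω] {g : Ω → ℝ} (h1 : ∀ ω, g ω ≤ 1) {q : ℝ}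
    (hq : q * Fintype.card Ω ≤ ∑ ω, g ω) :
    q / 2 * Fintype.card Ω ≤ ((Finset.univ.filter fun ω => q / 2 ≤ g ω).card : ℝ) := by
  by_cases hq0 : q < 0
  · exact (mul_nonpos_of_nonpos_of_nonneg (by linarith) (by positivity)).trans (by positivity)
  have h : ∑ ω, g ω ≤ ∑ ω, ((if q / 2 ≤ g ω then 1 else 0) + q / 2) := by
    refine Finset.sum_le_sum fun ω _ => ?_
    have := h1 ω
    split_ifs <;> linarith
  rw [Finset.sum_add_distrib, Finset.sum_boole, Finset.sum_const, Finset.card_univ,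
    nsmul_eq_mul] at h
  linarith

theorem exists_card_le_mul_card_fiber {α κ : Type*} {s : Finset α} {t : Finset κ}
    {f : α → κ} (hf : ∀ x ∈ s, f x ∈ t) (ht : t.Nonempty) :
    ∃ y ∈ t, (s.card : ℝ) ≤ t.card * ((s.filter fun x => f x = y).card : ℝ) := by
  have hc : (0 : ℝ) < t.card := by exact_mod_cast ht.card_pos
  obtain ⟨y, hy, h⟩ := Finset.exists_le_card_fiber_of_nsmul_le_card_of_maps_to
    (b := (s.card : ℝ) / t.card) hf ht (by rw [nsmul_eq_mul]; field_simp; rfl)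
  refine ⟨y, hy, ?_⟩
  rw [div_le_iff₀ hc] at h
  refine h.trans_eq ?_
  rw [mul_comm]

theorem card_often_mem_le {Ω ι : Type*} [Fintype ι] {E : Finset Ω} (hE : E.Nonempty)
    {J : Ω → Finset ι} {s : ℕ} (hJ : ∀ ω ∈ E, (J ω).card ≤ s) :
    (Finset.univ.filter fun j => E.card ≤ 16 * (E.filter fun ω => j ∈ J ω).card).card ≤ 16 * s := by
  set T := Finset.univ.filter fun j => E.card ≤ 16 * (E.filter fun ω => j ∈ J ω).card
  have h1 : T.card * E.card ≤ ∑ j ∈ T, 16 * (E.filter fun ω => j ∈ J ω).card := by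
    rw [← smul_eq_mul]
    exact Finset.card_nsmul_le_sum _ _ _ fun j hj => (Finset.mem_filter.1 hj).2
  have h2 : ∑ j ∈ T, (E.filter fun ω => j ∈ J ω).card ≤ E.card * s := by
    simp_rw [Finset.card_filter]
    rw [Finset.sum_comm, ← smul_eq_mul]
    refine Finset.sum_le_card_nsmul _ _ _ fun ω hω => (le_trans ?_ (hJ ω hω))
    rw [← Finset.card_filter]
    exact Finset.card_le_card fun j hj => (Finset.mem_filter.1 hj).2
  rw [← Finset.mul_sum] at h1
  refine Nat.le_of_mul_le_mul_right ?_ hE.card_pos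
  calc _ ≤ _ := h1
    _ ≤ 16 * (E.card * s) := by gcongr
    _ = _ := by ring

theorem pow_card_rarely_unselected_le {n : ℕ} {E : Finset (Fin n → Bool × Bool × Bool)}
    (hE0 : E.Nonempty) {L : ℝ} (hE : (8 : ℝ) ^ n ≤ L * E.card) :
    (108 / 97 : ℝ) ^ (Finset.univ.filter fun j =>
      8 * (E.filter fun ω => (ω j).1 = false).card ≤ E.card).card ≤ 2 * L := by
  set T := Finset.univ.filter fun j => 8 * (E.filter fun ω => (ω j).1 = false).card ≤ E.card
  set X : (Fin n → Bool × Bool × Bool) → ℕ := fun ω => (T.filter fun j => (ω j).1 = false).card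
    with hX
  have hsum : 8 * ∑ ω ∈ E, X ω ≤ T.card * E.card := by
    simp only [hX]
    simp_rw [Finset.card_filter]
    rw [Finset.sum_comm, Finset.mul_sum, ← smul_eq_mul]
    refine Finset.sum_le_card_nsmul _ _ _ fun j hj => ?_
    rw [← Finset.card_filter]
    exact (Finset.mem_filter.1 hj).2
  set E' := E.filter fun ω => 4 * X ω ≤ T.card
  have hE' : E.card ≤ 2 * E'.card := by
    have h1 : (E.filter fun ω => ¬ 4 * X ω ≤ T.card).card * (T.card + 1) ≤ ∑ ω ∈ E, 4 * X ω := by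
      rw [← smul_eq_mul]
      refine (Finset.card_nsmul_le_sum _ (fun ω => 4 * X ω) _ fun ω hω => ?_).trans
        (Finset.sum_le_sum_of_subset (Finset.filter_subset _ _))
      have := (Finset.mem_filter.1 hω).2
      omega
    have h2 : E'.card + (E.filter fun ω => ¬ 4 * X ω ≤ T.card).card = E.card :=
      Finset.card_filter_add_card_filter_not _
    rw [← Finset.mul_sum] at h1
    by_contra hlt
    have h3 : E.card + 1 ≤ 2 * (E.filter fun ω => ¬ 4 * X ω ≤ T.card).card := by omega
    have := hE0.card_pos
    nlinarith
  have htot : ∑ ω : Fin n → Bool × Bool × Bool, (16 / 81 : ℝ) ^ X ω =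
      8 ^ n * (97 / 162) ^ T.card := by
    have h1 : ∀ ω, (16 / 81 : ℝ) ^ X ω =
        ∏ j, if j ∈ T ∧ (ω j).1 = false then (16 / 81 : ℝ) else 1 := by
      intro ω
      rw [← Finset.prod_filter, Finset.prod_const]
      simp only [hX]
      congr 2
      ext j
      simp
    simp_rw [h1]
    have h2 := Finset.prod_univ_sum (fun _ : Fin n => (Finset.univ : Finset (Bool × Bool × Bool)))
      (fun j y => if j ∈ T ∧ y.1 = false then (16 / 81 : ℝ) else 1)
    rw [Fintype.piFinset_univ] at h2
    rw [← h2]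
    have h3 : ∀ j, ∑ y : Bool × Bool × Bool, (if j ∈ T ∧ y.1 = false then (16 / 81 : ℝ) else 1) =
        8 * if j ∈ T then (97 / 162 : ℝ) else 1 := by
      intro j
      by_cases hj : j ∈ T <;>
        (simp only [hj, Fintype.sum_prod_type, Fintype.sum_bool]; norm_num)
    simp_rw [h3]
    rw [Finset.prod_mul_distrib, Finset.prod_const, Finset.card_univ, Fintype.card_fin,
      Finset.prod_ite_mem, Finset.univ_inter, Finset.prod_const]
  have hlow : (E'.card : ℝ) * (2 / 3) ^ T.card ≤ ∑ ω : Fin n → Bool × Bool × Bool,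
      (16 / 81 : ℝ) ^ X ω := by
    rw [← nsmul_eq_mul]
    refine (Finset.card_nsmul_le_sum _ (fun ω => (16 / 81 : ℝ) ^ X ω) _ fun ω hω => ?_).trans
      (Finset.sum_le_sum_of_subset_of_nonneg (Finset.subset_univ _) fun _ _ _ => by positivity)
    rw [show (16 / 81 : ℝ) = (2 / 3) ^ 4 by norm_num, ← pow_mul]
    exact pow_le_pow_of_le_one (by norm_num) (by norm_num) (Finset.mem_filter.1 hω).2
  rw [htot] at hlow
  have hEr : (E.card : ℝ) ≤ 2 * E'.card := by exact_mod_cast hE'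
  have hpos : (0 : ℝ) < E.card := by exact_mod_cast hE0.card_pos
  have hL : 0 < L := by
    by_contra hL
    have : (0 : ℝ) < 8 ^ n := by positivity
    nlinarith
  rw [show (108 / 97 : ℝ) = (2 / 3) / (97 / 162) by norm_num, div_pow, div_le_iff₀ (by positivity)]
  refine le_of_mul_le_mul_left ?_ hpos
  calc (E.card : ℝ) * (2 / 3) ^ T.card ≤ 2 * E'.card * (2 / 3) ^ T.card := by gcongr
    _ ≤ 2 * (8 ^ n * (97 / 162) ^ T.card) := by linarith
    _ ≤ 2 * (L * E.card * (97 / 162) ^ T.card) := by gcongr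
    _ = _ := by ring

theorem exists_card_rarely_unselected_le (D : ℕ) : ∃ a₀ : ℕ, ∀ a ≥ a₀, ∀ {n : ℕ}
    {E : Finset (Fin n → Bool × Bool × Bool)}, E.Nonempty →
    (8 : ℝ) ^ n ≤ ((2 ^ (a + 1) : ℕ) : ℝ) ^ D * E.card →
    (Finset.univ.filter fun j =>
      8 * (E.filter fun ω => (ω j).1 = false).card ≤ E.card).card ≤ 2 ^ (a + 1) := by
  obtain ⟨a₀, h₀⟩ := exists_linear_lt_two_pow (7 * D) 14
  refine ⟨a₀, fun a ha n E hE0 hE => ?_⟩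
  have h1 := pow_card_rarely_unselected_le hE0 hE
  set m := (Finset.univ.filter fun j =>
      8 * (E.filter fun ω => (ω j).1 = false).card ≤ E.card).card
  refine le_trans ?_ (h₀ a ha).le
  have h2 : (2 : ℝ) ^ (m / 7) ≤ (2 : ℝ) ^ ((a + 1) * D + 1) := by
    calc (2 : ℝ) ^ (m / 7) ≤ ((108 / 97) ^ 7) ^ (m / 7) := by gcongr; norm_num
      _ = (108 / 97) ^ (7 * (m / 7)) := by rw [pow_mul]
      _ ≤ (108 / 97) ^ m := pow_le_pow_right₀ (by norm_num) (Nat.mul_div_le m 7)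
      _ ≤ _ := h1
      _ = _ := by rw [Nat.cast_pow, Nat.cast_ofNat, ← pow_mul, pow_succ']
  have h3 : m / 7 ≤ (a + 1) * D + 1 := (pow_le_pow_iff_right₀ (by norm_num)).1 h2
  have h4 : m < 7 * ((a + 1) * D + 1) + 7 := by omega
  have h5 : 7 * D * (a + 1) = 7 * ((a + 1) * D) := by ring
  omega

section

variable {n : ℕ}

theorem card_decForm_relation (A : Matrix (Fin n) (Fin n) ℝ) {r : ℕ} (w : Fin r → Fin n) (K : ℝ)
    (m : Fin r → ℤ) (j : Fin n) :
    ((Finset.univ.filter fun ω =>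
      K * decForm A ω j = ∑ l, (m l : ℝ) * decForm A ω (w l)).card : ℝ) =
      8 ^ n * (∏ i, lazyStep (1 / 8) (K * A i j - ∑ l, (m l : ℝ) * A i (w l))).coeff 0 := by
  have h := card_filter_sum_eq_zero sum_single_selDiff
    (fun i => K * A i j - ∑ l, (m l : ℝ) * A i (w l))
  simp only [Fintype.card_prod, Fintype.card_bool, Fintype.card_fin] at h
  norm_num at h
  rw [← h]
  have hiff : ∀ ω, K * decForm A ω j = ∑ l, (m l : ℝ) * decForm A ω (w l) ↔
      ∑ i, selDiff (ω i) * (K * A i j - ∑ l, (m l : ℝ) * A i (w l)) = 0 := by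
    intro ω
    rw [← sub_eq_zero]
    refine Eq.congr ?_ rfl
    simp only [decForm, Finset.mul_sum, mul_sub]
    rw [Finset.sum_sub_distrib, Finset.sum_comm]
    congr 1
    · exact Finset.sum_congr rfl fun i _ => by ring
    · exact Finset.sum_congr rfl fun i _ => Finset.sum_congr rfl fun l _ => by ring
  simp only [hiff]

theorem card_piFinset_Icc_le {r c M : ℕ} (hM : 2 ≤ M) :
    (Fintype.piFinset fun _ : Fin r => Finset.Icc (-((M ^ c : ℕ) : ℤ)) (M ^ c : ℕ)).card ≤
      M ^ ((c + 2) * r) := by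
  rw [Fintype.card_piFinset_const, Int.card_Icc, pow_mul]
  refine Nat.pow_le_pow_left ?_ _
  have h1 : 1 ≤ M ^ c := Nat.one_le_pow _ _ (by omega)
  have h2 : 4 * M ^ c ≤ M ^ (c + 2) := by
    rw [pow_add, mul_comm]
    exact Nat.mul_le_mul_left _ (by nlinarith)
  omega

/-- If the decoupled forms satisfy integer relations with fixed generators for all `ω` in a dense
set `E`, then most columns satisfy a fixed relation with noticeable probability. -/
theorem exists_coeff_relation {A : Matrix (Fin n) (Fin n) ℝ} {r c M K : ℕ} (hM : 2 ≤ M)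
    {w : Fin r → Fin n} {E : Finset (Fin n → Bool × Bool × Bool)} {L : ℕ}
    (hE : (8 : ℝ) ^ n ≤ (M : ℝ) ^ L * E.card)
    {m : (Fin n → Bool × Bool × Bool) → Fin n → Fin r → ℤ}
    {J : (Fin n → Bool × Bool × Bool) → Finset (Fin n)}
    (hm : ∀ ω ∈ E, ∀ i l, |m ω i l| ≤ (M ^ c : ℕ))
    (hrel : ∀ ω ∈ E, ∀ i ∉ J ω,
      (K : ℝ) * decCoeff A ω i = ∑ l, (m ω i l : ℝ) * decCoeff A ω (w l)) {j : Fin n}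
    (hj1 : 16 * (E.filter fun ω => j ∈ J ω).card < E.card)
    (hj2 : E.card < 8 * (E.filter fun ω => (ω j).1 = false).card) :
    ∃ k : Fin r → ℤ, (∀ l, |k l| ≤ (M ^ c : ℕ)) ∧ 1 ≤ (M : ℝ) ^ (L + 4 + (c + 2) * r) *
      (∏ i, lazyStep (1 / 8) ((K : ℝ) * A i j - ∑ l, (k l : ℝ) * A i (w l))).coeff 0 := by
  set G := E.filter fun ω => (ω j).1 = false ∧ j ∉ J ω
  have hG : E.card ≤ 16 * G.card := by
    have h1 : (E.filter fun ω => (ω j).1 = false).card ≤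
        G.card + (E.filter fun ω => j ∈ J ω).card := by
      refine (Finset.card_le_card ?_).trans (Finset.card_union_le _ _)
      intro ω hω
      rw [Finset.mem_filter] at hω
      by_cases h : j ∈ J ω
      · exact Finset.mem_union_right _ (Finset.mem_filter.2 ⟨hω.1, h⟩)
      · exact Finset.mem_union_left _ (Finset.mem_filter.2 ⟨hω.1, hω.2, h⟩)
    omega
  set f : (Fin n → Bool × Bool × Bool) → Fin r → ℤ := fun ω l =>
    if (ω (w l)).1 then 0 else m ω j l with hf
  have hmaps : ∀ ω ∈ G, f ω ∈
      Fintype.piFinset fun _ : Fin r => Finset.Icc (-((M ^ c : ℕ) : ℤ)) (M ^ c : ℕ) := by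
    intro ω hω
    rw [Fintype.mem_piFinset]
    intro l
    rw [Finset.mem_Icc, ← abs_le]
    simp only [hf]
    split_ifs
    · simp
    · exact hm ω (Finset.mem_filter.1 hω).1 j l
  obtain ⟨k, hk, hcard⟩ := exists_card_le_mul_card_fiber hmaps
    ⟨0, by rw [Fintype.mem_piFinset]; intro l; simp⟩
  refine ⟨k, fun l => ?_, ?_⟩
  · rw [abs_le, ← Finset.mem_Icc]
    exact Fintype.mem_piFinset.1 hk l
  have hsub : (G.filter fun ω => f ω = k).card ≤ (Finset.univ.filter fun ω =>
      (K : ℝ) * decForm A ω j = ∑ l, (k l : ℝ) * decForm A ω (w l)).card := by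
    refine Finset.card_le_card fun ω hω => ?_
    simp only [Finset.mem_filter, Finset.mem_univ, true_and, G] at hω ⊢
    obtain ⟨⟨hωE, hsel, hJ⟩, hfk⟩ := hω
    have := hrel ω hωE j hJ
    rw [decCoeff, hsel, if_neg (by simp)] at this
    rw [this, ← hfk]
    refine Finset.sum_congr rfl fun l _ => ?_
    simp only [decCoeff, hf]
    split_ifs <;> simp
  have hkey := card_decForm_relation A w K k j
  set x := (∏ i, lazyStep (1 / 8) ((K : ℝ) * A i j - ∑ l, (k l : ℝ) * A i (w l))).coeff 0
  have hp : (Fintype.piFinset fun _ : Fin r =>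
      Finset.Icc (-((M ^ c : ℕ) : ℤ)) (M ^ c : ℕ)).card ≤ (M : ℝ) ^ ((c + 2) * r) := by
    exact_mod_cast card_piFinset_Icc_le hM
  have hM16 : (16 : ℝ) ≤ (M : ℝ) ^ 4 := by
    have : (2 : ℝ) ≤ M := by exact_mod_cast hM
    calc (16 : ℝ) = 2 ^ 4 := by norm_num
      _ ≤ _ := by gcongr
  have h8 : (0 : ℝ) < 8 ^ n := by positivity
  refine le_of_mul_le_mul_left ?_ h8
  calc (8 : ℝ) ^ n * 1 ≤ (M : ℝ) ^ L * E.card := by rw [mul_one]; exact hE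
    _ ≤ (M : ℝ) ^ L * (16 * G.card) := by gcongr; exact_mod_cast hG
    _ ≤ (M : ℝ) ^ L * ((M : ℝ) ^ 4 * ((M : ℝ) ^ ((c + 2) * r) * (8 ^ n * x))) := by
        gcongr
        refine hcard.trans ?_
        rw [← hkey]
        exact mul_le_mul hp (Nat.cast_le.2 (by convert hsub)) (by positivity) (by positivity)
    _ = _ := by rw [pow_add, pow_add]; ring

/-- A dense set of `ω` on which the decoupled coefficients satisfy integer relations with common
generators and a common denominator. -/
theorem exists_common_generators (e d : ℕ) : ∃ r c L a₀ : ℕ, ∀ a ≥ a₀, ∀ {n : ℕ}, 0 < n →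
    n ≤ (2 ^ (a + 1)) ^ e → ∀ A : Matrix (Fin n) (Fin n) ℝ,
    (8 : ℝ) ^ n ≤ ((2 ^ (a + 1) : ℕ) : ℝ) ^ d *
      ∑ ω, (∏ j, lazyStep (1 / 4) (decCoeff A ω j)).coeff 0 →
    ∃ (w : Fin r → Fin n) (K : ℕ) (E : Finset (Fin n → Bool × Bool × Bool))
      (m : (Fin n → Bool × Bool × Bool) → Fin n → Fin r → ℤ)
      (J : (Fin n → Bool × Bool × Bool) → Finset (Fin n)),
      1 ≤ K ∧ K ≤ (2 ^ (a + 1)) ^ c ∧ (8 : ℝ) ^ n ≤ ((2 ^ (a + 1) : ℕ) : ℝ) ^ L * E.card ∧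
      (∀ ω ∈ E, ∀ i l, |m ω i l| ≤ ((2 ^ (a + 1)) ^ c : ℕ)) ∧
      (∀ ω ∈ E, (J ω).card ≤ (2 ^ (a + 1)) ^ 2) ∧
      ∀ ω ∈ E, ∀ i ∉ J ω,
        (K : ℝ) * decCoeff A ω i = ∑ l, (m ω i l : ℝ) * decCoeff A ω (w l) := by
  obtain ⟨r, c, a₀, h⟩ := exists_linear_inverse (2 * d + 3)
  refine ⟨r, c, e * r + c + (d + 1), a₀, fun a ha n hn hne A hA => ?_⟩
  have : Nonempty (Fin n) := ⟨⟨0, hn⟩⟩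
  set M := 2 ^ (a + 1) with hMdef
  have hM : 2 ≤ M := by
    rw [hMdef, pow_succ]
    have : 1 ≤ 2 ^ a := Nat.one_le_two_pow
    omega
  have hMr : (2 : ℝ) ≤ M := by exact_mod_cast hM
  set g : (Fin n → Bool × Bool × Bool) → ℝ := fun ω =>
    (∏ j, lazyStep (1 / 4) (decCoeff A ω j)).coeff 0 with hg
  have hcardΩ : (Fintype.card (Fin n → Bool × Bool × Bool) : ℝ) = 8 ^ n := by
    simp only [Fintype.card_fun, Fintype.card_prod, Fintype.card_bool, Fintype.card_fin]
    norm_num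
  have hMd : (0 : ℝ) < (M : ℝ) ^ d := by positivity
  set q : ℝ := ((M : ℝ) ^ d)⁻¹ with hq
  have hq' : ((M : ℝ) ^ (d + 1))⁻¹ ≤ q / 2 := by
    rw [hq, pow_succ, mul_inv, div_eq_mul_inv]
    gcongr
  have h1 := card_filter_half_le (g := g) (q := q)
    (fun ω => (IsSymmDist.prod _ fun j =>
      isSymmDist_lazyStep (by norm_num) (by norm_num) _).coeff_le_one 0)
    (by rw [hcardΩ, hq, inv_mul_le_iff₀ hMd]; exact hA)
  set S := Finset.univ.filter fun ω => q / 2 ≤ g ω with hS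
  have hSd : (8 : ℝ) ^ n ≤ (M : ℝ) ^ (d + 1) * S.card := by
    rw [hcardΩ] at h1
    have h2 : ((M : ℝ) ^ (d + 1))⁻¹ * 8 ^ n ≤ S.card := le_trans (by gcongr) h1
    rwa [inv_mul_le_iff₀ (by positivity)] at h2
  have hS' : ∀ ω ∈ S, 1 < (g ω) ^ 2 * (M : ℝ) ^ (2 * d + 3) := by
    intro ω hω
    have h2 : ((M : ℝ) ^ (d + 1))⁻¹ ≤ g ω := hq'.trans (Finset.mem_filter.1 hω).2
    calc (1 : ℝ) < M := by linarith
      _ = (((M : ℝ) ^ (d + 1))⁻¹) ^ 2 * (M : ℝ) ^ (2 * d + 3) := by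
        have : (M : ℝ) ≠ 0 := by positivity
        rw [show 2 * d + 3 = (d + 1) * 2 + 1 by ring, pow_succ (M : ℝ) ((d + 1) * 2),
          pow_mul]
        field_simp
      _ ≤ _ := by gcongr
  have hex := fun ω (hω : ω ∈ S) => h a ha (1 / 4) (by norm_num) le_rfl (decCoeff A ω) (hS' ω hω)
  choose! w K m J hK1 hK2 hm hJ hrel using hex
  obtain ⟨⟨w₀, K₀⟩, hmem, hE⟩ := exists_card_le_mul_card_fiber (s := S)
    (t := (Finset.univ : Finset (Fin r → Fin n)) ×ˢ Finset.Icc 1 (M ^ c))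
    (f := fun ω => (w ω, K ω))
    (fun ω hω => Finset.mem_product.2 ⟨Finset.mem_univ _, Finset.mem_Icc.2 ⟨hK1 ω hω, hK2 ω hω⟩⟩)
    ⟨(fun _ => ⟨0, hn⟩, 1), Finset.mem_product.2 ⟨Finset.mem_univ _, Finset.mem_Icc.2
      ⟨le_rfl, Nat.one_le_pow _ _ (by omega)⟩⟩⟩
  have hEm : ∀ ω ∈ S.filter fun ω => (w ω, K ω) = (w₀, K₀), ω ∈ S ∧ w ω = w₀ ∧ K ω = K₀ :=
    fun ω hω => by
      have := Finset.mem_filter.1 hω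
      exact ⟨this.1, (Prod.mk.inj this.2).1, (Prod.mk.inj this.2).2⟩
  have hK₀ := Finset.mem_Icc.1 (Finset.mem_product.1 hmem).2
  refine ⟨w₀, K₀, S.filter fun ω => (w ω, K ω) = (w₀, K₀), m, J, hK₀.1, hK₀.2, ?_,
    fun ω hω => hm ω (hEm ω hω).1, fun ω hω => hJ ω (hEm ω hω).1, fun ω hω i hi => ?_⟩
  · have hcard : ((Finset.univ : Finset (Fin r → Fin n)) ×ˢ Finset.Icc 1 (M ^ c)).card ≤
        M ^ (e * r + c) := by
      rw [Finset.card_product, Finset.card_univ, Fintype.card_fun, Fintype.card_fin,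
        Fintype.card_fin, Nat.card_Icc, pow_add, pow_mul]
      simp only [add_tsub_cancel_right]
      gcongr
    have hcard' : (((Finset.univ : Finset (Fin r → Fin n)) ×ˢ Finset.Icc 1 (M ^ c)).card : ℝ) ≤
        (M : ℝ) ^ (e * r + c) := by exact_mod_cast hcard
    calc (8 : ℝ) ^ n ≤ (M : ℝ) ^ (d + 1) * S.card := hSd
      _ ≤ (M : ℝ) ^ (d + 1) * ((M : ℝ) ^ (e * r + c) *
          (S.filter fun ω => (w ω, K ω) = (w₀, K₀)).card) := by
        gcongr
        exact hE.trans (by gcongr)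
      _ = _ := by rw [pow_add _ (e * r + c)]; ring
  · obtain ⟨hωS, rfl, rfl⟩ := hEm ω hω
    exact hrel ω hωS i hi

end

section

variable {n : ℕ}

/-- Outside a small set of indices, the matrix has integer row relations with common generators,
and each corrected row is highly concentrated. -/
theorem exists_concentrated_rows (e d : ℕ) : ∃ r c L a₀ : ℕ, ∀ a ≥ a₀, ∀ {n : ℕ}, 0 < n →
    n ≤ (2 ^ (a + 1)) ^ e → ∀ A : Matrix (Fin n) (Fin n) ℝ,
    (8 : ℝ) ^ n ≤ ((2 ^ (a + 1) : ℕ) : ℝ) ^ d *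
      ∑ ω, (∏ j, lazyStep (1 / 4) (decCoeff A ω j)).coeff 0 →
    ∃ (w : Fin r → Fin n) (K : ℕ) (m : Fin n → Fin r → ℤ) (I : Finset (Fin n)),
      1 ≤ K ∧ K ≤ (2 ^ (a + 1)) ^ c ∧ (∀ i l, |m i l| ≤ ((2 ^ (a + 1)) ^ c : ℕ)) ∧
      Iᶜ.card ≤ 17 * (2 ^ (a + 1)) ^ 2 + r ∧ (∀ l, w l ∉ I) ∧
      ∀ j ∈ I, 1 ≤ ((2 ^ (a + 1) : ℕ) : ℝ) ^ L *
        (∏ i, lazyStep (1 / 8) ((K : ℝ) * A i j - ∑ l, (m j l : ℝ) * A i (w l))).coeff 0 := by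
  obtain ⟨r, c, L, a₁, h₁⟩ := exists_common_generators e d
  obtain ⟨a₂, h₂⟩ := exists_card_rarely_unselected_le L
  refine ⟨r, c, L + 4 + (c + 2) * r, max a₁ a₂, fun a ha n hn hne A hA => ?_⟩
  obtain ⟨w, K, E, m, J, hK1, hK2, hE, hm, hJ, hrel⟩ :=
    h₁ a (le_of_max_le_left ha) hn hne A hA
  have hE0 : E.Nonempty := by
    rw [Finset.nonempty_iff_ne_empty]
    rintro rfl
    simp only [Finset.card_empty, Nat.cast_zero, mul_zero] at hE
    exact absurd hE (not_le.2 (by positivity))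
  have h2 := h₂ a (le_of_max_le_right ha) hE0 hE
  have h3 := card_often_mem_le hE0 hJ
  set M := 2 ^ (a + 1) with hMdef
  have hM : 2 ≤ M := by
    rw [hMdef, pow_succ]
    have : 1 ≤ 2 ^ a := Nat.one_le_two_pow
    omega
  set J₁ := Finset.univ.filter fun j => E.card ≤ 16 * (E.filter fun ω => j ∈ J ω).card
  set J₂ := Finset.univ.filter fun j => 8 * (E.filter fun ω => (ω j).1 = false).card ≤ E.card
  set I := (J₁ ∪ J₂ ∪ Finset.univ.image w)ᶜ
  have hex : ∀ j ∈ I, ∃ k : Fin r → ℤ, (∀ l, |k l| ≤ (M ^ c : ℕ)) ∧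
      1 ≤ (M : ℝ) ^ (L + 4 + (c + 2) * r) *
        (∏ i, lazyStep (1 / 8) ((K : ℝ) * A i j - ∑ l, (k l : ℝ) * A i (w l))).coeff 0 := by
    intro j hj
    simp only [I, J₁, J₂, Finset.mem_compl, Finset.mem_union, Finset.mem_filter,
      Finset.mem_univ, true_and, not_or, not_le] at hj
    exact exists_coeff_relation hM hE hm hrel hj.1.1 hj.1.2
  choose! k hk1 hk2 using hex
  refine ⟨w, K, fun j => if j ∈ I then k j else 0, I, hK1, hK2, fun i l => ?_, ?_, fun l hl => ?_,
    fun j hj => ?_⟩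
  · dsimp only
    split_ifs with hi
    · exact hk1 i hi l
    · simp
  · rw [compl_compl]
    refine (Finset.card_union_le _ _).trans (add_le_add ((Finset.card_union_le _ _).trans ?_) ?_)
    · have h4 : J₁.card ≤ 16 * M ^ 2 := by convert h3
      have h5 : M ≤ M ^ 2 := by nlinarith
      omega
    · exact Finset.card_image_le.trans (by simp)
  · simp only [I, Finset.mem_compl, Finset.mem_union, not_or] at hl
    exact hl.2 (Finset.mem_image_of_mem _ (Finset.mem_univ l))
  · dsimp only
    rw [if_pos hj]
    exact hk2 j hj

/-- Structure of a symmetric matrix whose decoupled concentration is polynomially large, at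
scale `2 ^ (a + 1)`. -/
theorem exists_structure (e d : ℕ) : ∃ r R c a₀ : ℕ, ∀ a ≥ a₀, ∀ {n : ℕ}, 0 < n →
    n ≤ (2 ^ (a + 1)) ^ e → ∀ A : Matrix (Fin n) (Fin n) ℝ, A.IsSymm →
    (8 : ℝ) ^ n ≤ ((2 ^ (a + 1) : ℕ) : ℝ) ^ d *
      ∑ ω, (∏ j, lazyStep (1 / 4) (decCoeff A ω j)).coeff 0 →
    ∃ (w : Fin r → Fin n) (K : ℕ) (m : Fin n → Fin r → ℤ) (I : Finset (Fin n)),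
      1 ≤ K ∧ K ≤ (2 ^ (a + 1)) ^ c ∧ (∀ i l, |m i l| ≤ ((2 ^ (a + 1)) ^ c : ℕ)) ∧
      Iᶜ.card ≤ 17 * (2 ^ (a + 1)) ^ 2 + r ∧ (∀ l, w l ∉ I) ∧
      ∀ i ∈ I, ∃ Q : Set ℝ, IsProperSymGAPSet Q R (((2 ^ (a + 1) : ℕ) : ℝ) ^ c) ∧
        (Finset.univ.filter fun j => (K : ℝ) ^ 2 * A i j - K * ∑ l, (m i l : ℝ) * A (w l) j -
          K * ∑ l, (m j l : ℝ) * A (w l) i ∉ Q).card ≤ (2 ^ (a + 1)) ^ 2 := by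
  obtain ⟨r, c, L, a₁, h₁⟩ := exists_concentrated_rows e d
  obtain ⟨r', c', a₂, h₂⟩ := exists_linear_inverse (2 * L + 1)
  set B := max c c' + 1
  refine ⟨r, r' + r, B * ((4 ^ (r' + r) + 2) * (r' + r)) + B, max a₁ a₂,
    fun a ha n hn hne A hsymm hA => ?_⟩
  obtain ⟨w, K, m, I, hK1, hK2, hm, hI, hw, hconc⟩ := h₁ a (le_of_max_le_left ha) hn hne A hA
  have h₂ := h₂ a (le_of_max_le_right ha)
  have : Nonempty (Fin n) := ⟨⟨0, hn⟩⟩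
  set M := 2 ^ (a + 1) with hMdef
  have hM : 2 ≤ M := by
    rw [hMdef, pow_succ]
    have : 1 ≤ 2 ^ a := Nat.one_le_two_pow
    omega
  have hMr : (2 : ℝ) ≤ M := by exact_mod_cast hM
  have hcB : ∀ t, M ^ c ≤ M ^ (t + B) := fun t => Nat.pow_le_pow_right (by omega) (by omega)
  have hcB' : M ^ c ≤ M ^ B := Nat.pow_le_pow_right (by omega) (by omega)
  have hcB'' : M ^ c' ≤ M ^ B := Nat.pow_le_pow_right (by omega) (by omega)
  have hB2 : 2 ≤ M ^ B := hM.trans (Nat.le_self_pow (by omega) M)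
  refine ⟨w, K, m, I, hK1, hK2.trans (hcB _), fun i l => (hm i l).trans (by exact_mod_cast hcB _),
    hI, hw, fun i hi => ?_⟩
  set v : Fin n → ℝ := fun j => (K : ℝ) * A j i - ∑ l, (m i l : ℝ) * A j (w l) with hv
  have hx := hconc i hi
  have hlarge : 1 < ((∏ j, lazyStep (1 / 8) (v j)).coeff 0) ^ 2 * (M : ℝ) ^ (2 * L + 1) := by
    calc (1 : ℝ) < M := by linarith
      _ = 1 ^ 2 * M := by ring
      _ ≤ ((M : ℝ) ^ L * (∏ j, lazyStep (1 / 8) (v j)).coeff 0) ^ 2 * M := by gcongr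
      _ = _ := by rw [pow_succ _ (2 * L), pow_mul']; ring
  obtain ⟨w', K', m', J, hK1', -, hm', hJ, hrel⟩ := h₂ (1 / 8) le_rfl (by norm_num) v hlarge
  obtain ⟨Q, hQ, hmem⟩ := exists_proper_gap hB2
    (Fin.append (fun l => (K : ℝ) * v (w' l) / K') (fun l => (K : ℝ) * A (w l) i))
  refine ⟨Q, ?_, (Finset.card_le_card fun j hj => ?_).trans hJ⟩
  · obtain ⟨s, g, N, hs, hQ', hinj, hN⟩ := hQ
    refine ⟨s, g, N, hs, hQ', hinj, hN.trans ?_⟩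
    rw [Nat.cast_pow, ← pow_mul]
    exact pow_le_pow_right₀ (by linarith) (by omega)
  · by_contra hjJ
    refine (Finset.mem_filter.1 hj).2 ?_
    have hK' : (K' : ℝ) ≠ 0 := by
      have : K' ≠ 0 := by omega
      exact_mod_cast this
    have hin := hmem (Fin.append (m' j) (fun l => -m j l)) (by
      intro l
      refine Fin.addCases (fun l => ?_) (fun l => ?_) l
      · rw [Fin.append_left]
        exact (hm' j l).trans (by exact_mod_cast hcB'')
      · rw [Fin.append_right, abs_neg]
        exact (hm j l).trans (by exact_mod_cast hcB'))
    rw [Fin.sum_univ_add] at hin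
    simp only [Fin.append_left, Fin.append_right] at hin
    convert hin using 1
    have h5 := hrel j hjJ
    have h6 : ∑ l, (m' j l : ℝ) * ((K : ℝ) * v (w' l) / K') = K * v j := by
      rw [show (K : ℝ) * v j = K / K' * (K' * v j) by field_simp, h5, Finset.mul_sum]
      exact Finset.sum_congr rfl fun l _ => by ring
    have h7 : ∑ l, ((-m j l : ℤ) : ℝ) * ((K : ℝ) * A (w l) i) =
        -(K * ∑ l, (m j l : ℝ) * A (w l) i) := by
      rw [Finset.mul_sum, ← Finset.sum_neg_distrib]
      exact Finset.sum_congr rfl fun l _ => by push_cast; ring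
    have h8 : v j = K * A i j - ∑ l, (m i l : ℝ) * A (w l) j := by
      simp only [hv, hsymm.apply _ j]
    rw [h6, h7, h8]
    ring

theorem exists_concentrated_value {A : Matrix (Fin n) (Fin n) ℝ} {p : ℝ} (hp : p < rhoQ n A) :
    ∃ α : ℝ, p < ((Finset.univ.filter fun x : Fin n → Bool =>
      ∑ i, ∑ j, A i j * signv (x i) * signv (x j) = α).card : ℝ) / 2 ^ n :=
  exists_lt_of_lt_ciSup hp

/-- A dyadic scale comparable to a small power of `n`. -/
theorem exists_dyadic_scale {ε : ℝ} (hε0 : 0 < ε) (hε1 : ε < 1) (a₀ : ℕ) :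
    ∃ n₀ : ℕ, ∀ n ≥ n₀, 0 < n ∧ ∃ a ≥ a₀, ((2 ^ (a + 1) : ℕ) : ℝ) ^ 2 ≤ (n : ℝ) ^ ε ∧
      2 ^ (a + 1) ≤ n ∧ n ≤ (2 ^ (a + 1)) ^ ⌈4 / ε⌉₊ := by
  refine ⟨max 1 ⌈((2 : ℝ) ^ (a₀ + 1)) ^ (2 / ε)⌉₊, fun n hn => ?_⟩
  have hn1 : 1 ≤ n := le_of_max_le_left hn
  have hn2 : ((2 : ℝ) ^ (a₀ + 1)) ^ (2 / ε) ≤ n := Nat.ceil_le.1 (le_of_max_le_right hn)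
  have hnr : (1 : ℝ) ≤ n := by exact_mod_cast hn1
  have hpow : (2 : ℝ) ^ (a₀ + 1) ≤ (n : ℝ) ^ (ε / 2) := by
    have := Real.rpow_le_rpow (by positivity) hn2 (show 0 ≤ ε / 2 by positivity)
    rw [← Real.rpow_mul (by positivity)] at this
    rwa [show 2 / ε * (ε / 2) = 1 by field_simp, Real.rpow_one] at this
  set s := ⌊(n : ℝ) ^ (ε / 2)⌋₊ with hs
  have hs1 : 2 ^ (a₀ + 1) ≤ s := Nat.le_floor (by exact_mod_cast hpow)
  have hs0 : s ≠ 0 := by have : 0 < 2 ^ (a₀ + 1) := by positivity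
                         omega
  have hlog : a₀ + 1 ≤ Nat.log 2 s := Nat.le_log_of_pow_le (by norm_num) hs1
  obtain ⟨a, ha⟩ : ∃ a, Nat.log 2 s = a + 1 := ⟨Nat.log 2 s - 1, by omega⟩
  have hle : 2 ^ (a + 1) ≤ s := ha ▸ Nat.pow_log_le_self 2 hs0
  have hlt : s < 2 ^ (a + 1 + 1) := ha ▸ Nat.lt_pow_succ_log_self (by norm_num) s
  have hleR : ((2 ^ (a + 1) : ℕ) : ℝ) ≤ (n : ℝ) ^ (ε / 2) :=
    (Nat.cast_le.2 hle).trans (Nat.floor_le (by positivity))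
  refine ⟨hn1, a, by omega, ?_, ?_, ?_⟩
  · calc ((2 ^ (a + 1) : ℕ) : ℝ) ^ 2 ≤ ((n : ℝ) ^ (ε / 2)) ^ 2 := by gcongr
      _ = (n : ℝ) ^ ε := by
        rw [← Real.rpow_natCast, ← Real.rpow_mul (by positivity)]
        congr 1
        push_cast
        ring
  · have : ((2 ^ (a + 1) : ℕ) : ℝ) ≤ (n : ℝ) := hleR.trans <| by
      calc (n : ℝ) ^ (ε / 2) ≤ (n : ℝ) ^ (1 : ℝ) :=
            Real.rpow_le_rpow_of_exponent_le hnr (by linarith)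
        _ = n := Real.rpow_one _
    exact_mod_cast this
  · have h1 : (n : ℝ) ^ (ε / 2) ≤ ((2 ^ (a + 1) : ℕ) : ℝ) ^ 2 := by
      refine (Nat.lt_floor_add_one _).le.trans ?_
      have h2 : s + 1 ≤ (2 ^ (a + 1)) ^ 2 := by
        have h3 : 2 ^ (a + 1 + 1) = 2 ^ (a + 1) * 2 := pow_succ _ _
        have h4 : 2 ≤ 2 ^ (a + 1) := Nat.le_self_pow (by omega) 2
        nlinarith
      exact_mod_cast h2
    have hM1 : (1 : ℝ) ≤ ((2 ^ (a + 1) : ℕ) : ℝ) := by exact_mod_cast Nat.one_le_two_pow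
    have h5 : (n : ℝ) ≤ ((2 ^ (a + 1) : ℕ) : ℝ) ^ ⌈4 / ε⌉₊ := by
      calc (n : ℝ) = ((n : ℝ) ^ (ε / 2)) ^ (2 / ε) := by
            rw [← Real.rpow_mul (by positivity), show ε / 2 * (2 / ε) = 1 by field_simp,
              Real.rpow_one]
        _ ≤ (((2 ^ (a + 1) : ℕ) : ℝ) ^ 2) ^ (2 / ε) := by gcongr
        _ = ((2 ^ (a + 1) : ℕ) : ℝ) ^ (4 / ε) := by
            rw [← Real.rpow_natCast, ← Real.rpow_mul (by positivity)]
            congr 1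
            push_cast
            ring
        _ ≤ ((2 ^ (a + 1) : ℕ) : ℝ) ^ ((⌈4 / ε⌉₊ : ℕ) : ℝ) :=
            Real.rpow_le_rpow_of_exponent_le hM1 (Nat.le_ceil _)
        _ = _ := Real.rpow_natCast _ _
    exact_mod_cast h5

theorem le_mul_sum_coeff_of_rpow_le_rhoQ {A : Matrix (Fin n) (Fin n) ℝ} (hA : A.IsSymm)
    (hn : 0 < n) {C : ℝ} (hρ : (n : ℝ) ^ (-C) ≤ rhoQ n A) {M e : ℕ} (hM : 2 ≤ M)
    (hne : n ≤ M ^ e) :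
    (8 : ℝ) ^ n ≤ (M : ℝ) ^ (4 * (e * ⌈C⌉₊ + 1)) *
      ∑ ω, (∏ j, lazyStep (1 / 4) (decCoeff A ω j)).coeff 0 := by
  have hnr : (1 : ℝ) ≤ n := by exact_mod_cast hn
  have hn0 : (0 : ℝ) < n := by linarith
  have hMr : (2 : ℝ) ≤ M := by exact_mod_cast hM
  obtain ⟨α, hα⟩ := exists_concentrated_value (p := (n : ℝ) ^ (-C) / 2)
    ((half_lt_self (Real.rpow_pos_of_pos hn0 _)).trans_le hρ)
  have hdec := decoupling hA α
  set p := ((Finset.univ.filter fun x : Fin n → Bool =>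
      ∑ i, ∑ j, A i j * signv (x i) * signv (x j) = α).card : ℝ) / 2 ^ n
  have h1 : (n : ℝ) ^ C ≤ (M : ℝ) ^ (e * ⌈C⌉₊) := by
    calc (n : ℝ) ^ C ≤ (n : ℝ) ^ ((⌈C⌉₊ : ℕ) : ℝ) :=
          Real.rpow_le_rpow_of_exponent_le hnr (Nat.le_ceil _)
      _ = (n : ℝ) ^ ⌈C⌉₊ := Real.rpow_natCast _ _
      _ ≤ ((M : ℝ) ^ e) ^ ⌈C⌉₊ := by gcongr; exact_mod_cast hne
      _ = _ := by rw [pow_mul]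
  have h2 : 1 ≤ (M : ℝ) ^ (e * ⌈C⌉₊ + 1) * p := by
    calc (1 : ℝ) = (n : ℝ) ^ C * 2 * ((n : ℝ) ^ (-C) / 2) := by
          rw [Real.rpow_neg hn0.le]
          field_simp
      _ ≤ (M : ℝ) ^ (e * ⌈C⌉₊) * M * p := by gcongr
      _ = _ := by rw [pow_succ]
  calc (8 : ℝ) ^ n = 1 ^ 4 * 8 ^ n := by ring
    _ ≤ ((M : ℝ) ^ (e * ⌈C⌉₊ + 1) * p) ^ 4 * 8 ^ n := by gcongr
    _ = (M : ℝ) ^ (4 * (e * ⌈C⌉₊ + 1)) * (p ^ 4 * 8 ^ n) := by rw [pow_mul']; ring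
    _ ≤ _ := by gcongr

end

end QuadLO

/-- Inverse Littlewood-Offord theorem for quadratic forms. -/
theorem inverse_LO_quadratic (ε C : ℝ) (hε0 : 0 < ε) (hε1 : ε < 1) (hC : 0 < C) :
    ∃ r₀ : ℕ, ∃ c : ℝ, 0 < c ∧ ∃ n₀ : ℕ, ∀ n : ℕ, n₀ ≤ n →
      ∀ A : Matrix (Fin n) (Fin n) ℝ, A.IsSymm → (n : ℝ) ^ (-C) ≤ rhoQ n A →
        ∃ (I₀ I : Finset (Fin n)) (k : ℤ) (kk : Fin n → Fin n → ℤ)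
          (a' : Fin n → Fin n → ℝ),
          Disjoint I I₀ ∧ I₀.card ≤ r₀ ∧
          (n : ℝ) - c * (n : ℝ) ^ ε ≤ (I.card : ℝ) ∧
          k ≠ 0 ∧ |(k : ℝ)| ≤ (n : ℝ) ^ c ∧
          (∀ i ∈ I, ∀ i₀ ∈ I₀, |(kk i i₀ : ℝ)| ≤ (n : ℝ) ^ c) ∧
          ∀ i ∈ I,
            (∀ j ∈ I, A i j = a' i j / ((k : ℝ) ^ 2)
                - (∑ i₀ ∈ I₀, (kk i i₀ : ℝ) * A i₀ j) / (k : ℝ)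
                - (∑ i₀ ∈ I₀, (kk j i₀ : ℝ) * A i₀ i) / (k : ℝ)) ∧
            (∃ Q : Set ℝ, IsProperSymGAPSet Q r₀ ((n : ℝ) ^ c) ∧
              ((I.filter fun j => a' i j ∉ Q).card : ℝ) ≤ c * (n : ℝ) ^ ε) := by
  obtain ⟨r, R, c, a₀, h⟩ := QuadLO.exists_structure ⌈4 / ε⌉₊ (4 * (⌈4 / ε⌉₊ * ⌈C⌉₊ + 1))
  obtain ⟨n₀, hn₀⟩ := QuadLO.exists_dyadic_scale hε0 hε1 a₀
  refine ⟨r + R, ((17 + r + c : ℕ) : ℝ), by positivity, n₀, fun n hn A hA hρ => ?_⟩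
  obtain ⟨hn1, a, ha, hMε, hMn, hnM⟩ := hn₀ n hn
  have hM : 2 ≤ 2 ^ (a + 1) := Nat.le_self_pow (by omega) 2
  obtain ⟨w, K, m, I, hK1, hK2, hm, hI, hw, hrow⟩ := h a ha hn1 hnM A hA
    (QuadLO.le_mul_sum_coeff_of_rpow_le_rhoQ hA hn1 hρ hM hnM)
  set M := 2 ^ (a + 1)
  have hMn' : ∀ t ≤ r + c, (M : ℝ) ^ t ≤ (n : ℝ) ^ ((17 + r + c : ℕ) : ℝ) := by
    intro t ht
    rw [Real.rpow_natCast]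
    have hn1' : (1 : ℝ) ≤ n := by exact_mod_cast hn1
    calc (M : ℝ) ^ t ≤ (n : ℝ) ^ t := by gcongr
      _ ≤ _ := pow_le_pow_right₀ hn1' (by omega)
  have hM1 : (1 : ℝ) ≤ (M : ℝ) ^ 2 := by
    have : (2 : ℝ) ≤ M := by exact_mod_cast hM
    nlinarith
  have hK0 : (K : ℝ) ≠ 0 := by
    have : K ≠ 0 := by omega
    exact_mod_cast this
  have hsum : ∀ (b : Fin r → ℤ) (f : Fin n → ℝ), ∑ i₀ ∈ Finset.univ.image w,
      ((-∑ l ∈ Finset.univ.filter (fun l => w l = i₀), b l : ℤ) : ℝ) * f i₀ =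
      -∑ l, (b l : ℝ) * f (w l) := by
    intro b f
    rw [← Finset.sum_fiberwise_of_maps_to (t := Finset.univ.image w) (g := w)
      fun l _ => Finset.mem_image_of_mem _ (Finset.mem_univ l), ← Finset.sum_neg_distrib]
    refine Finset.sum_congr rfl fun i₀ _ => ?_
    push_cast
    rw [neg_mul, Finset.sum_mul]
    refine congrArg _ (Finset.sum_congr rfl fun l hl => ?_)
    rw [(Finset.mem_filter.1 hl).2]
  refine ⟨Finset.univ.image w, I, K,
    fun i i₀ => -∑ l ∈ Finset.univ.filter (fun l => w l = i₀), m i l,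
    fun i j => (K : ℝ) ^ 2 * A i j - K * ∑ l, (m i l : ℝ) * A (w l) j -
      K * ∑ l, (m j l : ℝ) * A (w l) i, ?_, ?_, ?_, ?_, ?_, ?_, fun i hi => ⟨fun j _ => ?_, ?_⟩⟩
  · rw [Finset.disjoint_right]
    intro i₀ hi₀
    obtain ⟨l, -, rfl⟩ := Finset.mem_image.1 hi₀
    exact hw l
  · exact Finset.card_image_le.trans (by simp)
  · have h1 : (I.card : ℝ) + (Iᶜ.card : ℝ) = n := by
      have := Finset.card_add_card_compl I
      rw [Fintype.card_fin] at this
      exact_mod_cast this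
    have h2 : (Iᶜ.card : ℝ) ≤ 17 * (M : ℝ) ^ 2 + r := by exact_mod_cast hI
    have h3 : (r : ℝ) ≤ r * (M : ℝ) ^ 2 := le_mul_of_one_le_right (by positivity) hM1
    have h4 : ((17 + r + c : ℕ) : ℝ) * (M : ℝ) ^ 2 ≤ ((17 + r + c : ℕ) : ℝ) * (n : ℝ) ^ ε := by
      gcongr
    have h5 : 0 ≤ (c : ℝ) * (M : ℝ) ^ 2 := by positivity
    push_cast at h4 ⊢
    nlinarith
  · omega
  · rw [Int.cast_natCast, Nat.abs_cast]
    exact le_trans (by exact_mod_cast hK2) (hMn' c (by omega))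
  · intro i _ i₀ _
    refine le_trans ?_ (hMn' (r + c) le_rfl)
    have h1 : |-∑ l ∈ Finset.univ.filter (fun l => w l = i₀), m i l| ≤ r * (M ^ c : ℕ) := by
      rw [abs_neg]
      calc _ ≤ ∑ l ∈ Finset.univ.filter (fun l => w l = i₀), |m i l| :=
            Finset.abs_sum_le_sum_abs _ _
        _ ≤ ∑ l, |m i l| := Finset.sum_le_sum_of_subset_of_nonneg (Finset.subset_univ _)
            fun _ _ _ => abs_nonneg _
        _ ≤ ∑ _l : Fin r, ((M ^ c : ℕ) : ℤ) := Finset.sum_le_sum fun l _ => hm i l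
        _ = _ := by simp
    have h2 : (r : ℝ) ≤ (M : ℝ) ^ r := by
      have : r < M ^ r := Nat.lt_pow_self (by omega)
      exact_mod_cast this.le
    calc |((-∑ l ∈ Finset.univ.filter (fun l => w l = i₀), m i l : ℤ) : ℝ)| ≤
          r * (M : ℝ) ^ c := by exact_mod_cast h1
      _ ≤ (M : ℝ) ^ r * (M : ℝ) ^ c := by gcongr
      _ = _ := (pow_add _ _ _).symm
  · rw [hsum (m i) fun i₀ => A i₀ j, hsum (m j) fun i₀ => A i₀ i, Int.cast_natCast]
    field_simp
    ring
  · obtain ⟨Q, ⟨s, g, N, hs, hQ, hinj, hN⟩, hcard⟩ := hrow i hi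
    refine ⟨Q, ⟨s, g, N, by omega, hQ, hinj, hN.trans (hMn' c (by omega))⟩, ?_⟩
    have h1 : ((Finset.univ.filter fun j => (K : ℝ) ^ 2 * A i j - K * ∑ l, (m i l : ℝ) * A (w l) j -
          K * ∑ l, (m j l : ℝ) * A (w l) i ∉ Q).card : ℝ) ≤ (M : ℝ) ^ 2 := by exact_mod_cast hcard
    have h2 : (1 : ℝ) ≤ ((17 + r + c : ℕ) : ℝ) := by
      have : 1 ≤ 17 + r + c := by omega
      exact_mod_cast this
    calc _ ≤ _ := Nat.cast_le.2 (Finset.card_le_card (Finset.filter_subset_filter _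
          (Finset.subset_univ I)))
      _ ≤ (M : ℝ) ^ 2 := h1
      _ ≤ (n : ℝ) ^ ε := hMε
      _ ≤ _ := le_mul_of_one_le_left (by positivity) h2

end
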